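/- arXiv:2107.03097 — 4 statements merged into one kernel-verified Lean document; each statement's English description precedes it below -/
import Mathlib

section
/- Let r and s be integers with 2 ≤ r ≤ s − 2, let f(X) = X·(X − r)·(X − s) − 1, and let α be a real root of f. Then α and α − r are units of the ring ℤ[α] (the subring of ℝ generated by ℤ and α), and every unit u of ℤ[α] can be written as u = ± α^a · (α − r)^b for some integers a, b. -/
/-- the three coordinates of a point of the plane -/
def thV1 (x y d q1 q2 : ℝ) : ℝ := -(x + y) * q1 + (x + d) * q2
def thV2 (x z d q1 q2 : ℝ) : ℝ := x * q1 - (x + d + z) * q2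
def thV3 (y z q1 q2 : ℝ) : ℝ := y * q1 + z * q2

def thGood (x y z d c q1 q2 : ℝ) : Prop :=
  |thV1 x y d q1 q2 - thV2 x z d q1 q2| < c ∧ |thV1 x y d q1 q2 - thV3 y z q1 q2| < c ∧
    |thV2 x z d q1 q2 - thV3 y z q1 q2| < c


theorem thomas_cover_unit (x y z d c p1 p2 : ℝ) (hx : 0 ≤ x) (hz : 0 ≤ z) (hd : 0 ≤ d)
    (hxy : x ≤ y) (hzy : z ≤ y) (hdy : d ≤ y)
    (h1 : 2 * x + 2 * y + 2 * z + d < 3 * c) (h2 : 2 * y + x + 2 * d < 2 * c)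
    (h3 : 2 * y + z + 2 * d < 2 * c) (hp1 : 0 ≤ p1) (hp2 : 0 ≤ p2) (hp1' : p1 ≤ 1)
    (hp2' : p2 ≤ 1) : ∃ m n : ℤ, thGood x y z d c (p1 + m) (p2 + n) := by
  have key : thGood x y z d c p1 p2 ∨ thGood x y z d c (p1 - 1) (p2 - 1) ∨
      thGood x y z d c p1 (p2 - 1) ∨ thGood x y z d c (p1 - 1) p2 := by
    by_contra! hc
    obtain ⟨k1, k2, k3, k4⟩ := hc
    have a1 := mul_nonneg hx hp1
    have a2 := mul_nonneg hz hp1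
    have a3 := mul_nonneg hd hp1
    have a4 := mul_nonneg (sub_nonneg.2 hxy) hp1
    have a5 := mul_nonneg (sub_nonneg.2 hzy) hp1
    have a6 := mul_nonneg (sub_nonneg.2 hdy) hp1
    have b1 := mul_nonneg hx (sub_nonneg.2 hp2')
    have b2 := mul_nonneg hz (sub_nonneg.2 hp2')
    have b3 := mul_nonneg hd (sub_nonneg.2 hp2')
    have b4 := mul_nonneg (sub_nonneg.2 hxy) (sub_nonneg.2 hp2')
    have b5 := mul_nonneg (sub_nonneg.2 hzy) (sub_nonneg.2 hp2')
    have b6 := mul_nonneg (sub_nonneg.2 hdy) (sub_nonneg.2 hp2')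
    have a1' := mul_nonneg hx hp2
    have a2' := mul_nonneg hz hp2
    have a3' := mul_nonneg hd hp2
    have a4' := mul_nonneg (sub_nonneg.2 hxy) hp2
    have a5' := mul_nonneg (sub_nonneg.2 hzy) hp2
    have a6' := mul_nonneg (sub_nonneg.2 hdy) hp2
    have b1' := mul_nonneg hx (sub_nonneg.2 hp1')
    have b2' := mul_nonneg hz (sub_nonneg.2 hp1')
    have b3' := mul_nonneg hd (sub_nonneg.2 hp1')
    have b4' := mul_nonneg (sub_nonneg.2 hxy) (sub_nonneg.2 hp1')
    have b5' := mul_nonneg (sub_nonneg.2 hzy) (sub_nonneg.2 hp1')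
    have b6' := mul_nonneg (sub_nonneg.2 hdy) (sub_nonneg.2 hp1')
    unfold thGood thV1 thV2 thV3 at k1 k2 k3 k4
    simp only [not_and_or, not_lt, le_abs] at k1 k2 k3 k4
    rcases le_total p1 p2 with hp | hp
    · clear k4
      have c1 := mul_nonneg hx (sub_nonneg.2 hp)
      have c2 := mul_nonneg hz (sub_nonneg.2 hp)
      have c3 := mul_nonneg hd (sub_nonneg.2 hp)
      have c4 := mul_nonneg (sub_nonneg.2 hxy) (sub_nonneg.2 hp)
      have c5 := mul_nonneg (sub_nonneg.2 hzy) (sub_nonneg.2 hp)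
      have c6 := mul_nonneg (sub_nonneg.2 hdy) (sub_nonneg.2 hp)
      clear a1' a2' a3' a4' a5' a6' b1' b2' b3' b4' b5' b6'
      set A := x * p1
      ring_nf at *
      rcases k1 with (k1 | k1) | (k1 | k1) | (k1 | k1) <;>
      rcases k2 with (k2 | k2) | (k2 | k2) | (k2 | k2) <;>
      first
      | (exfalso; linarith)
      | (rcases k3 with (k3 | k3) | (k3 | k3) | (k3 | k3) <;> linarith)
    · clear k3
      have c1 := mul_nonneg hx (sub_nonneg.2 hp)
      have c2 := mul_nonneg hz (sub_nonneg.2 hp)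
      have c3 := mul_nonneg hd (sub_nonneg.2 hp)
      have c4 := mul_nonneg (sub_nonneg.2 hxy) (sub_nonneg.2 hp)
      have c5 := mul_nonneg (sub_nonneg.2 hzy) (sub_nonneg.2 hp)
      have c6 := mul_nonneg (sub_nonneg.2 hdy) (sub_nonneg.2 hp)
      clear a1 a2 a3 a4 a5 a6 b1 b2 b3 b4 b5 b6
      ring_nf at *
      rcases k1 with (k1 | k1) | (k1 | k1) | (k1 | k1) <;>
      rcases k2 with (k2 | k2) | (k2 | k2) | (k2 | k2) <;>
      first
      | (exfalso; linarith)
      | (rcases k4 with (k4 | k4) | (k4 | k4) | (k4 | k4) <;> linarith)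
  rcases key with h | h | h | h
  · exact ⟨0, 0, by simpa using h⟩
  · exact ⟨-1, -1, by simpa [sub_eq_add_neg] using h⟩
  · exact ⟨0, -1, by simpa [sub_eq_add_neg] using h⟩
  · exact ⟨-1, 0, by simpa [sub_eq_add_neg] using h⟩

theorem thomas_cover (x y z d c p1 p2 : ℝ) (hx : 0 ≤ x) (hz : 0 ≤ z) (hd : 0 ≤ d)
    (hxy : x ≤ y) (hzy : z ≤ y) (hdy : d ≤ y)
    (h1 : 2 * x + 2 * y + 2 * z + d < 3 * c) (h2 : 2 * y + x + 2 * d < 2 * c)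
    (h3 : 2 * y + z + 2 * d < 2 * c) :
    ∃ m n : ℤ, thGood x y z d c (p1 + m) (p2 + n) := by
  obtain ⟨m, n, h⟩ := thomas_cover_unit x y z d c (Int.fract p1) (Int.fract p2) hx hz hd hxy hzy
    hdy h1 h2 h3 (Int.fract_nonneg _) (Int.fract_nonneg _) (Int.fract_lt_one _).le
    (Int.fract_lt_one _).le
  refine ⟨m - ⌊p1⌋, n - ⌊p2⌋, ?_⟩
  have e1 : Int.fract p1 + m = p1 + ((m - ⌊p1⌋ : ℤ) : ℝ) := by
    unfold Int.fract; push_cast; ring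
  have e2 : Int.fract p2 + n = p2 + ((n - ⌊p2⌋ : ℤ) : ℝ) := by
    unfold Int.fract; push_cast; ring
  rwa [e1, e2] at h

theorem th_poly_bound (x y : ℝ) (hx : |x| ≤ 1) (hy : |y| ≤ 1) :
    |(1 - x) * (1 - y) * (1 - x * y)| ≤ 2 := by
  rw [abs_le] at hx hy
  obtain ⟨hx1, hx2⟩ := hx
  obtain ⟨hy1, hy2⟩ := hy
  have hxy : 0 ≤ 1 - x * y := by nlinarith
  have h0 : 0 ≤ (1 - x) * (1 - y) * (1 - x * y) :=
    mul_nonneg (mul_nonneg (by linarith) (by linarith)) hxy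
  rw [abs_of_nonneg h0]
  rcases le_total 0 x with h | h <;> rcases le_total 0 y with h' | h'
  · have := mul_nonneg h h'
    have e1 : (1 - x) * (1 - y) ≤ 1 := by nlinarith
    have e2 : 0 ≤ (1 - x) * (1 - y) := mul_nonneg (by linarith) (by linarith)
    nlinarith
  · have e1 : (1 - x) * (1 - x * y) ≤ 1 := by
      nlinarith [mul_nonneg h (by linarith : 0 ≤ 1 + y), mul_nonneg h h, mul_nonneg (mul_nonneg h h) (by linarith : 0 ≤ 1 + y)]
    have e2 : 0 ≤ (1 - x) * (1 - x * y) := mul_nonneg (by linarith) (by linarith)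
    nlinarith
  · have e1 : (1 - y) * (1 - x * y) ≤ 1 := by
      nlinarith [mul_nonneg h' (by linarith : 0 ≤ 1 + x), mul_nonneg h' h', mul_nonneg (mul_nonneg h' h') (by linarith : 0 ≤ 1 + x)]
    have e2 : 0 ≤ (1 - y) * (1 - x * y) := mul_nonneg (by linarith) (by linarith)
    nlinarith
  ·
    have hp : 0 ≤ x * y := mul_nonneg_of_nonpos_of_nonpos h h'
    have hs : -(x + y) ≤ 1 + x * y := by nlinarith [mul_nonneg (by linarith : 0 ≤ 1 + x) (by linarith : 0 ≤ 1 + y)]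
    nlinarith [mul_nonneg hxy (by linarith : 0 ≤ 1 + x * y + (x + y)), mul_nonneg hp hp]

theorem th_disc_sorted (a b c : ℝ) (hb : |b| ≤ |a|) (hc : |c| ≤ |b|) (h : |a * b * c| = 1) (M : ℝ)
    (hM : |a| < M * |c|) : |(a - b) * (a - c) * (b - c)| < 2 * M := by
  have ha0 : a ≠ 0 := by rintro rfl; simp at h
  have hb0 : b ≠ 0 := by rintro rfl; simp at h
  have hc0 : c ≠ 0 := by rintro rfl; simp at h
  have hc' : 0 < |c| := abs_pos.2 hc0
  have e : (a - b) * (a - c) * (b - c) = a * a * b * ((1 - b / a) * (1 - c / b) * (1 - b / a * (c / b))) := by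
    field_simp
  have h2 := th_poly_bound (b / a) (c / b) (by rw [abs_div]; exact div_le_one_of_le₀ hb (abs_nonneg _))
    (by rw [abs_div]; exact div_le_one_of_le₀ hc (abs_nonneg _))
  rw [e, abs_mul]
  have h3 : |a * a * b| < M := by
    have : |a * a * b| * |c| = |a| := by
      rw [← abs_mul, show a * a * b * c = a * (a * b * c) by ring, abs_mul, h, mul_one]
    nlinarith
  nlinarith [abs_nonneg (a * a * b)]

theorem th_disc (a b c : ℝ) (h : |a * b * c| = 1) (M : ℝ)
    (h1 : |a| < M * |b|) (h2 : |a| < M * |c|) (h3 : |b| < M * |a|) (h4 : |b| < M * |c|)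
    (h5 : |c| < M * |a|) (h6 : |c| < M * |b|) : |(a - b) * (a - c) * (b - c)| < 2 * M := by
  rcases le_total (|a|) (|b|) with hab | hab <;> rcases le_total (|b|) (|c|) with hbc | hbc <;>
    rcases le_total (|a|) (|c|) with hac | hac
  · have := th_disc_sorted c b a hbc hab (by rw [← h]; congr 1; ring) M h5
    rw [← abs_neg]; convert this using 2; ring
  · have := th_disc_sorted c b a hbc hab (by rw [← h]; congr 1; ring) M h5
    rw [← abs_neg]; convert this using 2; ring
  · have := th_disc_sorted b c a hbc hac (by rw [← h]; congr 1; ring) M h3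
    convert this using 2; ring
  · have := th_disc_sorted b a c hab hac (by rw [← h]; congr 1; ring) M h4
    rw [← abs_neg]; convert this using 2; ring
  · have := th_disc_sorted c a b hac hab (by rw [← h]; congr 1; ring) M h6
    convert this using 2; ring
  · have := th_disc_sorted a c b hac hbc (by rw [← h]; congr 1; ring) M h1
    rw [← abs_neg]; convert this using 2; ring
  · have := th_disc_sorted a b c hab hbc (by rw [← h]) M h2
    convert this using 2
  · have := th_disc_sorted a b c hab hbc (by rw [← h]) M h2
    convert this using 2

open Polynomial in
/-- The Thomas polynomial. -/
noncomputable def thF (r s : ℤ) : ℤ[X] := X ^ 3 + (-C (r + s) * X ^ 2 + C (r * s) * X + C (-1))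

open Polynomial in
theorem thF_low (r s : ℤ) : (-C (r + s) * X ^ 2 + C (r * s) * X + C (-1) : ℤ[X]).degree < 3 := by
  have : (-C (r + s) * X ^ 2 + C (r * s) * X + C (-1) : ℤ[X]).degree ≤ 2 := by compute_degree
  exact lt_of_le_of_lt this (by norm_num)

theorem thF_monic (r s : ℤ) : (thF r s).Monic :=
  Polynomial.monic_X_pow_add (by exact_mod_cast thF_low r s)

theorem thF_natDegree (r s : ℤ) : (thF r s).natDegree = 3 := by
  unfold thF; compute_degree!

theorem thF_aeval (r s : ℤ) (t : ℝ) :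
    Polynomial.aeval t (thF r s) = t * (t - r) * (t - s) - 1 := by
  simp [thF]; ring

theorem thF_irred (r s : ℤ) (hr : 2 ≤ r) (hs : r ≤ s - 2) : Irreducible (thF r s) := by
  rw [(thF_monic r s).irreducible_iff_roots_eq_zero_of_degree_le_three
    (by rw [thF_natDegree]; norm_num) (by rw [thF_natDegree])]
  rw [Multiset.eq_zero_iff_forall_notMem]
  intro t ht
  have h1 := Polynomial.isRoot_of_mem_roots ht
  have h2 : t * ((t - r) * (t - s)) = 1 := by
    simp [thF, Polynomial.IsRoot.def] at h1
    linarith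
  rcases Int.eq_one_or_neg_one_of_mul_eq_one h2 with rfl | rfl
  · nlinarith
  · nlinarith

theorem thF_dvd (r s : ℤ) (hr : 2 ≤ r) (hs : r ≤ s - 2) (t : ℝ)
    (ht : t * (t - r) * (t - s) - 1 = 0) (P : Polynomial ℤ) (hP : Polynomial.aeval t P = 0) :
    thF r s ∣ P := by
  have hint : IsIntegral ℤ t := ⟨thF r s, thF_monic r s, by
    rw [← Polynomial.aeval_def, thF_aeval, ht]⟩
  have h1 : minpoly ℤ t ∣ thF r s :=
    minpoly.isIntegrallyClosed_dvd hint (by rw [thF_aeval, ht])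
  have h2 : Associated (minpoly ℤ t) (thF r s) :=
    ((thF_irred r s hr hs).dvd_iff.1 h1).resolve_left (minpoly.not_isUnit ℤ t) |>.symm
  exact h2.symm.dvd.trans (minpoly.isIntegrallyClosed_dvd hint hP)

open Polynomial in
theorem th_indep (r s : ℤ) (hr : 2 ≤ r) (hs : r ≤ s - 2) (t : ℝ)
    (ht : t * (t - r) * (t - s) - 1 = 0) (a b c : ℤ) (h : (a : ℝ) + b * t + c * t ^ 2 = 0) :
    a = 0 ∧ b = 0 ∧ c = 0 := by
  have h1 : thF r s ∣ C c * X ^ 2 + C b * X + C a :=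
    thF_dvd r s hr hs t ht _ (by simp; linarith)
  have h2 : (C c * X ^ 2 + C b * X + C a : ℤ[X]) = 0 := by
    apply eq_zero_of_dvd_of_natDegree_lt h1
    rw [thF_natDegree]
    have : (C c * X ^ 2 + C b * X + C a : ℤ[X]).natDegree ≤ 2 := by compute_degree
    omega
  refine ⟨?_, ?_, ?_⟩
  · have := congrArg (fun p => coeff p 0) h2; simpa [-eq_intCast, coeff_X, coeff_C] using this
  · have := congrArg (fun p => coeff p 1) h2; simpa [-eq_intCast, coeff_X, coeff_C] using this
  · have := congrArg (fun p => coeff p 2) h2; simpa [-eq_intCast, coeff_X, coeff_C] using this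

theorem th_rep (r s : ℤ) (P : Polynomial ℤ) : ∃ a b c : ℤ, ∀ t : ℝ,
    t * (t - r) * (t - s) - 1 = 0 → Polynomial.aeval t P = (a : ℝ) + b * t + c * t ^ 2 := by
  induction P using Polynomial.induction_on with
  | C a => exact ⟨a, 0, 0, fun t _ => by simp⟩
  | add p q hp hq =>
    obtain ⟨a, b, c, h⟩ := hp
    obtain ⟨a', b', c', h'⟩ := hq
    refine ⟨a + a', b + b', c + c', fun t ht => ?_⟩
    rw [map_add, h t ht, h' t ht]; push_cast; ring
  | monomial n a ih =>
    obtain ⟨x, y, z, h⟩ := ih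
    refine ⟨z, x - z * (r * s), y + z * (r + s), fun t ht => ?_⟩
    rw [pow_succ, ← mul_assoc, map_mul, h t ht, Polynomial.aeval_X]
    push_cast
    linear_combination (z : ℝ) * ht

/-- `w` is (the vector of conjugates of) a unit. -/
def thU (t w : Fin 3 → ℝ) : Prop :=
  ∃ P Q : Polynomial ℤ, ∀ i, w i = Polynomial.aeval (t i) P ∧ w i * Polynomial.aeval (t i) Q = 1

theorem thU.mul {t w w' : Fin 3 → ℝ} (h : thU t w) (h' : thU t w') : thU t (w * w') := by
  obtain ⟨P, Q, h⟩ := h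
  obtain ⟨P', Q', h'⟩ := h'
  refine ⟨P * P', Q * Q', fun i => ?_⟩
  obtain ⟨h1, h2⟩ := h i
  obtain ⟨h3, h4⟩ := h' i
  simp only [Pi.mul_apply, map_mul]
  refine ⟨by rw [h1, h3], ?_⟩
  calc _ = (w i * Polynomial.aeval (t i) Q) * (w' i * Polynomial.aeval (t i) Q') := by ring
    _ = 1 := by rw [h2, h4, one_mul]

theorem thU.inv {t w : Fin 3 → ℝ} (h : thU t w) : thU t w⁻¹ := by
  obtain ⟨P, Q, h⟩ := h
  refine ⟨Q, P, fun i => ?_⟩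
  obtain ⟨h1, h2⟩ := h i
  simp only [Pi.inv_apply]
  refine ⟨inv_eq_of_mul_eq_one_right h2, ?_⟩
  rw [← h1]
  exact inv_mul_cancel₀ (left_ne_zero_of_mul_eq_one h2)

theorem thU.pow {t w : Fin 3 → ℝ} (h : thU t w) (n : ℕ) : thU t (w ^ n) := by
  induction n with
  | zero => exact ⟨1, 1, fun i => by simp⟩
  | succ n ih => rw [pow_succ]; exact ih.mul h

theorem thU.zpow {t w : Fin 3 → ℝ} (h : thU t w) (n : ℤ) : thU t (w ^ n) := by
  cases n with
  | ofNat n => simpa using h.pow n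
  | negSucc n => rw [zpow_negSucc]; exact (h.pow _).inv

theorem th_norm_int (r s : ℤ) (t : Fin 3 → ℝ) (e1 : t 0 + t 1 + t 2 = r + s)
    (e2 : t 0 * t 1 + t 0 * t 2 + t 1 * t 2 = r * s) (e3 : t 0 * t 1 * t 2 = 1) (a b c : ℤ) :
    ∃ N : ℤ, ((a : ℝ) + b * t 0 + c * t 0 ^ 2) * (a + b * t 1 + c * t 1 ^ 2) *
      (a + b * t 2 + c * t 2 ^ 2) = N := by
  refine ⟨a^3 + a^2*b*(r+s) + a^2*c*((r+s)^2-2*(r*s)) + a*b^2*(r*s) + a*b*c*((r+s)*(r*s)-3*1)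
    + a*c^2*((r*s)^2-2*(r+s)*1) + b^3*1 + b^2*c*(r+s)*1 + b*c^2*(r*s)*1 + c^3*1^2, ?_⟩
  push_cast
  rw [← e1, ← e2]
  linear_combination (-3 * (a : ℝ) * b * c - 2 * a * c ^ 2 * (t 0 + t 1 + t 2) + b ^ 3
    + b ^ 2 * c * (t 0 + t 1 + t 2) + b * c ^ 2 * (t 0 * t 1 + t 0 * t 2 + t 1 * t 2)
    + c ^ 3 * (t 0 * t 1 * t 2 + 1)) * e3

theorem thU.norm (r s : ℤ) {t w : Fin 3 → ℝ} (e1 : t 0 + t 1 + t 2 = r + s)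
    (e2 : t 0 * t 1 + t 0 * t 2 + t 1 * t 2 = r * s) (e3 : t 0 * t 1 * t 2 = 1)
    (ht : ∀ i, t i * (t i - r) * (t i - s) - 1 = 0) (h : thU t w) :
    |w 0 * w 1 * w 2| = 1 := by
  obtain ⟨P, Q, h⟩ := h
  obtain ⟨a, b, c, hP⟩ := th_rep r s P
  obtain ⟨a', b', c', hQ⟩ := th_rep r s Q
  obtain ⟨N, hN⟩ := th_norm_int r s t e1 e2 e3 a b c
  obtain ⟨N', hN'⟩ := th_norm_int r s t e1 e2 e3 a' b' c'
  rw [← hP _ (ht _), ← hP _ (ht _), ← hP _ (ht _), ← (h _).1, ← (h _).1, ← (h _).1] at hN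
  rw [← hQ _ (ht _), ← hQ _ (ht _), ← hQ _ (ht _)] at hN'
  have h1 : (N : ℝ) * N' = 1 := by
    rw [← hN, ← hN']
    calc _ = (w 0 * Polynomial.aeval (t 0) Q) * (w 1 * Polynomial.aeval (t 1) Q) *
      (w 2 * Polynomial.aeval (t 2) Q) := by ring
      _ = 1 := by rw [(h 0).2, (h 1).2, (h 2).2]; norm_num
  have h2 : N * N' = 1 := by exact_mod_cast h1
  rw [hN]
  rcases Int.eq_one_or_neg_one_of_mul_eq_one h2 with rfl | rfl <;> simp

/-- A unit all of whose conjugates are close in absolute value is trivial. -/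
theorem thU.small (r s : ℤ) (hr : 2 ≤ r) (hs : r ≤ s - 2) {t w : Fin 3 → ℝ}
    (e1 : t 0 + t 1 + t 2 = r + s)
    (e2 : t 0 * t 1 + t 0 * t 2 + t 1 * t 2 = r * s) (e3 : t 0 * t 1 * t 2 = 1)
    (ht : ∀ i, t i * (t i - r) * (t i - s) - 1 = 0) (h : thU t w)
    (hD : |(w 0 - w 1) * (w 0 - w 2) * (w 1 - w 2)| <
      |(t 0 - t 1) * (t 0 - t 2) * (t 1 - t 2)|) :
    (∀ i, w i = 1) ∨ (∀ i, w i = -1) := by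
  have hn := h.norm r s e1 e2 e3 ht
  obtain ⟨P, Q, h⟩ := h
  obtain ⟨a, b, c, hP⟩ := th_rep r s P
  have hw : ∀ i, w i = a + b * t i + c * t i ^ 2 := fun i => by rw [(h i).1, hP _ (ht i)]
  by_cases hbc : b = 0 ∧ c = 0
  · obtain ⟨rfl, rfl⟩ := hbc
    simp only [Int.cast_zero, zero_mul, add_zero] at hw
    simp only [hw] at hn
    have h1 : |a * a * a| = 1 := by exact_mod_cast hn
    have h2 : IsUnit a := by
      have : IsUnit (a * a * a) := Int.isUnit_iff_abs_eq.2 h1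
      exact isUnit_of_mul_isUnit_right this
    rcases Int.isUnit_iff.1 h2 with rfl | rfl
    · left; intro i; simp [hw]
    · right; intro i; simp [hw]
  · exfalso
    obtain ⟨N, hN⟩ := th_norm_int r s t e1 e2 e3 (b + c * (r + s)) (-c) 0
    have hN0 : N ≠ 0 := by
      rintro rfl
      have hne : ∀ i, ((b + c * (r + s) : ℤ) : ℝ) + ((-c : ℤ) : ℝ) * t i + ((0 : ℤ) : ℝ) * t i ^ 2 ≠ 0 := by
        intro i h0
        obtain ⟨k1, k2, -⟩ := th_indep r s hr hs (t i) (ht i) _ _ _ h0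
        have : c = 0 := by omega
        subst this
        exact hbc ⟨by simpa using k1, rfl⟩
      exact mul_ne_zero (mul_ne_zero (hne 0) (hne 1)) (hne 2) (hN.trans Int.cast_zero)
    have hN1 : (1 : ℝ) ≤ |(N : ℝ)| := by exact_mod_cast Int.one_le_abs hN0
    have key : (w 0 - w 1) * (w 0 - w 2) * (w 1 - w 2) =
        (t 0 - t 1) * (t 0 - t 2) * (t 1 - t 2) * N := by
      rw [← hN, hw, hw, hw]
      push_cast
      rw [← e1]
      ring
    rw [key, abs_mul] at hD
    nlinarith [abs_nonneg ((t 0 - t 1) * (t 0 - t 2) * (t 1 - t 2))]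

theorem th_closure (α u : ℝ) (hu : u ∈ Subring.closure {α}) :
    ∃ P : Polynomial ℤ, u = Polynomial.aeval α P := by
  induction hu using Subring.closure_induction with
  | mem x hx => exact ⟨Polynomial.X, by simpa using hx⟩
  | zero => exact ⟨0, by simp⟩
  | one => exact ⟨1, by simp⟩
  | add x y _ _ hx hy =>
    obtain ⟨P, rfl⟩ := hx
    obtain ⟨Q, rfl⟩ := hy
    exact ⟨P + Q, by simp⟩
  | neg x _ hx =>
    obtain ⟨P, rfl⟩ := hx
    exact ⟨-P, by simp⟩
  | mul x y _ _ hx hy =>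
    obtain ⟨P, rfl⟩ := hx
    obtain ⟨Q, rfl⟩ := hy
    exact ⟨P * Q, by simp⟩

theorem thU_of_unit (r s : ℤ) (hr : 2 ≤ r) (hs : r ≤ s - 2) {t : Fin 3 → ℝ}
    (ht : ∀ i, t i * (t i - r) * (t i - s) - 1 = 0) (j : Fin 3) (u v : ℝ)
    (hu : u ∈ Subring.closure {t j}) (hv : v ∈ Subring.closure {t j}) (huv : u * v = 1) :
    ∃ w, thU t w ∧ w j = u := by
  obtain ⟨P, rfl⟩ := th_closure _ _ hu
  obtain ⟨Q, rfl⟩ := th_closure _ _ hv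
  refine ⟨fun i => Polynomial.aeval (t i) P, ⟨P, Q, fun i => ⟨rfl, ?_⟩⟩, rfl⟩
  obtain ⟨R, hR⟩ := thF_dvd r s hr hs (t j) (ht j) (P * Q - 1) (by simp [huv])
  have := congrArg (Polynomial.aeval (t i)) hR
  rw [map_mul, thF_aeval, ht i] at this
  simp only [map_sub, map_mul, map_one, zero_mul] at this
  linarith

theorem th_ivt (r s : ℝ) (a b : ℝ) (hab : a ≤ b)
    (h : (a * (a - r) * (a - s) - 1) * (b * (b - r) * (b - s) - 1) < 0) :
    ∃ t, a < t ∧ t < b ∧ t * (t - r) * (t - s) - 1 = 0 := by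
  have hc : ContinuousOn (fun t : ℝ => t * (t - r) * (t - s) - 1) (Set.Icc a b) := by fun_prop
  rcases mul_neg_iff.1 h with ⟨h1, h2⟩ | ⟨h1, h2⟩
  · obtain ⟨t, ht, h0⟩ := intermediate_value_Ioo' hab hc (Set.mem_Ioo.2 ⟨h2, h1⟩)
    exact ⟨t, ht.1, ht.2, h0⟩
  · obtain ⟨t, ht, h0⟩ := intermediate_value_Ioo hab hc (Set.mem_Ioo.2 ⟨h1, h2⟩)
    exact ⟨t, ht.1, ht.2, h0⟩

theorem th_roots (r s : ℝ) (hr : 2 ≤ r) (hs : r ≤ s - 2) : ∃ t0 t1 t2 : ℝ,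
    (t0 * (t0 - r) * (t0 - s) - 1 = 0 ∧ t1 * (t1 - r) * (t1 - s) - 1 = 0 ∧
      t2 * (t2 - r) * (t2 - s) - 1 = 0) ∧
    0 < t0 ∧ t0 < 0.14 ∧ r - 0.26 < t1 ∧ t1 < r ∧ s < t2 ∧ t2 < s + 1 / 8 := by
  obtain ⟨t0, h1, h2, h3⟩ := th_ivt r s 0 0.14 (by norm_num) (by
    have : (1.86 : ℝ) * 3.86 ≤ (r - 0.14) * (s - 0.14) :=
      mul_le_mul (by linarith) (by linarith) (by norm_num) (by linarith)
    nlinarith)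
  obtain ⟨t1, h4, h5, h6⟩ := th_ivt r s (r - 0.26) r (by linarith) (by
    have : (1.74 : ℝ) * 2.26 ≤ (r - 0.26) * (s - r + 0.26) :=
      mul_le_mul (by linarith) (by linarith) (by norm_num) (by linarith)
    nlinarith)
  obtain ⟨t2, h7, h8, h9⟩ := th_ivt r s s (s + 1 / 8) (by linarith) (by
    have : (33 / 8 : ℝ) * (17 / 8) ≤ (s + 1 / 8) * (s + 1 / 8 - r) :=
      mul_le_mul (by linarith) (by linarith) (by norm_num) (by linarith)
    nlinarith)
  exact ⟨t0, t1, t2, ⟨h3, h6, h9⟩, h1, h2, h4, h5, h7, h8⟩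

theorem th_vieta (r s t0 t1 t2 : ℝ) (h0 : t0 * (t0 - r) * (t0 - s) - 1 = 0)
    (h1 : t1 * (t1 - r) * (t1 - s) - 1 = 0) (h2 : t2 * (t2 - r) * (t2 - s) - 1 = 0)
    (h01 : t0 ≠ t1) (h02 : t0 ≠ t2) (h12 : t1 ≠ t2) :
    t0 + t1 + t2 = r + s ∧ t0 * t1 + t0 * t2 + t1 * t2 = r * s ∧ t0 * t1 * t2 = 1 := by
  have k1 : t0 ^ 2 + t0 * t1 + t1 ^ 2 - (r + s) * (t0 + t1) + r * s = 0 :=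
    mul_left_cancel₀ (sub_ne_zero.2 h01) (by linear_combination h0 - h1)
  have k2 : t0 ^ 2 + t0 * t2 + t2 ^ 2 - (r + s) * (t0 + t2) + r * s = 0 :=
    mul_left_cancel₀ (sub_ne_zero.2 h02) (by linear_combination h0 - h2)
  have k3 : t0 + t1 + t2 - (r + s) = 0 :=
    mul_left_cancel₀ (sub_ne_zero.2 h12) (by linear_combination k1 - k2)
  have k4 : t0 * t1 + t0 * t2 + t1 * t2 = r * s := by
    linear_combination (t0 + t1) * k3 - k1
  refine ⟨by linarith, k4, ?_⟩
  linear_combination h0 + t0 * k4 - t0 ^ 2 * k3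

theorem th_log_bounds (r s t0 t1 t2 : ℝ) (hr : 2 ≤ r) (hs : r ≤ s - 2)
    (a1 : 0 < t0) (a2 : t0 < 0.14) (a3 : r - 0.26 < t1) (a4 : t1 < r) (a5 : s < t2)
    (a6 : t2 < s + 1 / 8) (x y z d c : ℝ) (hx : x = Real.log t1) (hy : y = Real.log t2)
    (hz : z = Real.log (t2 - r)) (hd : d = Real.log (t2 / (s - t0)))
    (hc : c = Real.log ((t1 - t0) * (t2 - t0) * (t2 - t1) / 2)) :
    0 < x ∧ 0 < z ∧ 0 ≤ d ∧ x ≤ y ∧ z ≤ y ∧ d ≤ y ∧ 2 * x + 2 * y + 2 * z + d < 3 * c ∧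
      2 * y + x + 2 * d < 2 * c ∧ 2 * y + z + 2 * d < 2 * c := by
  have p0 : 0 < s - t0 := by linarith
  have hx0 : 0 < x := by rw [hx]; exact Real.log_pos (by linarith)
  have hz0 : 0 < z := by rw [hz]; exact Real.log_pos (by linarith)
  have hd0 : 0 ≤ d := by rw [hd]; exact Real.log_nonneg (by rw [le_div_iff₀ p0]; linarith)
  have hxy : x ≤ y := by rw [hx, hy]; exact Real.log_le_log (by linarith) (by linarith)
  have hzy : z ≤ y := by rw [hz, hy]; exact Real.log_le_log (by linarith) (by linarith)
  have hd1 : d ≤ Real.log 1.07 := by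
    rw [hd]; exact Real.log_le_log (div_pos (by linarith) p0) (by rw [div_le_iff₀ p0]; linarith)
  have hdy : d ≤ y := hd1.trans (by rw [hy]; exact Real.log_le_log (by norm_num) (by linarith))
  have hx1 : Real.log 1.74 ≤ x := by rw [hx]; exact Real.log_le_log (by norm_num) (by linarith)
  have hy1 : Real.log 4 ≤ y := by rw [hy]; exact Real.log_le_log (by norm_num) (by linarith)
  have hz1 : Real.log 2 ≤ z := by rw [hz]; exact Real.log_le_log (by norm_num) (by linarith)
  have hc1 : x + y + z - Real.log 2.26 ≤ c := by
    rw [hx, hy, hz, hc, ← Real.log_mul (by linarith) (by linarith),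
      ← Real.log_mul (by apply mul_ne_zero <;> linarith) (by linarith),
      ← Real.log_div (by apply mul_ne_zero (mul_ne_zero _ _) <;> linarith) (by norm_num)]
    have q1 : 0 < t1 := by linarith
    have q2 : 0 < t2 := by linarith
    have q3 : 0 < t2 - r := by linarith
    apply Real.log_le_log (by positivity)
    have b1 : 0.9195 * t1 ≤ t1 - t0 := by linarith
    have b2 : 0.965 * t2 ≤ t2 - t0 := by linarith
    have b3 : (0.9195 * t1) * (0.965 * t2) * (t2 - r) ≤ (t1 - t0) * (t2 - t0) * (t2 - t1) := by
      apply mul_le_mul (mul_le_mul b1 b2 (by positivity) (by linarith)) (by linarith) q3.le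
      apply mul_nonneg <;> linarith
    rw [div_le_div_iff₀ (by norm_num) (by norm_num)]
    have b4 : 0 < t1 * t2 * (t2 - r) := by positivity
    nlinarith
  have n1 : 3 * Real.log 2.26 + Real.log 1.07 < Real.log 1.74 + Real.log 4 + Real.log 2 := by
    have : Real.log (2.26 ^ 3 * 1.07) < Real.log (1.74 * 4 * 2) :=
      Real.log_lt_log (by norm_num) (by norm_num)
    rw [Real.log_mul (by norm_num) (by norm_num), Real.log_pow,
      Real.log_mul (by norm_num) (by norm_num), Real.log_mul (by norm_num) (by norm_num)] at this
    exact_mod_cast this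
  have n2 : 2 * Real.log 2.26 + 2 * Real.log 1.07 < Real.log 1.74 + 2 * Real.log 2 := by
    have : Real.log (2.26 ^ 2 * 1.07 ^ 2) < Real.log (1.74 * 2 ^ 2) :=
      Real.log_lt_log (by norm_num) (by norm_num)
    rw [Real.log_mul (by norm_num) (by norm_num), Real.log_pow, Real.log_pow,
      Real.log_mul (by norm_num) (by norm_num), Real.log_pow] at this
    exact_mod_cast this
  have n3 : 2 * Real.log 2.26 + 2 * Real.log 1.07 < 2 * Real.log 1.74 + Real.log 2 := by
    have : Real.log (2.26 ^ 2 * 1.07 ^ 2) < Real.log (1.74 ^ 2 * 2) :=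
      Real.log_lt_log (by norm_num) (by norm_num)
    rw [Real.log_mul (by norm_num) (by norm_num), Real.log_pow, Real.log_pow,
      Real.log_mul (by norm_num) (by norm_num), Real.log_pow] at this
    exact_mod_cast this
  refine ⟨hx0, hz0, hd0, hxy, hzy, hdy, ?_, ?_, ?_⟩ <;> linarith

theorem th_log_lt (a b M : ℝ) (ha : a ≠ 0) (hb : b ≠ 0) (hM : 0 < M)
    (h : Real.log |a| - Real.log |b| < Real.log M) : |a| < M * |b| := by
  rw [← Real.log_lt_log_iff (abs_pos.2 ha) (mul_pos hM (abs_pos.2 hb)),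
    Real.log_mul hM.ne' (abs_ne_zero.2 hb)]
  linarith

/-- The core: every unit is, up to sign, a product of powers. -/
theorem th_core (r s : ℤ) (hr : 2 ≤ r) (hs : r ≤ s - 2) (t : Fin 3 → ℝ)
    (ht : ∀ i, t i * (t i - r) * (t i - s) - 1 = 0)
    (a1 : 0 < t 0) (a2 : t 0 < 0.14) (a3 : r - 0.26 < t 1) (a4 : t 1 < r) (a5 : s < t 2)
    (a6 : t 2 < s + 1 / 8) (w : Fin 3 → ℝ) (hw : thU t w) :
    ∃ m n : ℤ, (∀ i, w i = t i ^ m * (t i - r) ^ n) ∨ (∀ i, w i = -(t i ^ m * (t i - r) ^ n)) := by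
  have hr' : (2 : ℝ) ≤ r := by exact_mod_cast hr
  have hs' : (r : ℝ) ≤ s - 2 := by exact_mod_cast hs
  obtain ⟨e1, e2, e3⟩ := th_vieta r s (t 0) (t 1) (t 2) (ht 0) (ht 1) (ht 2)
    (by intro h; linarith) (by intro h; linarith) (by intro h; linarith)
  set M := (t 1 - t 0) * (t 2 - t 0) * (t 2 - t 1) / 2 with hM
  have hM0 : 0 < M := by
    have : 0 < t 1 - t 0 := by linarith
    have : 0 < t 2 - t 0 := by linarith
    have : 0 < t 2 - t 1 := by linarith
    positivity
  set x := Real.log (t 1) with hx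
  set y := Real.log (t 2) with hy
  set z := Real.log (t 2 - r) with hz
  set d := Real.log (t 2 / (s - t 0)) with hd
  set c := Real.log M with hc
  obtain ⟨b1, b2, b3, b4, b5, b6, b7, b8, b9⟩ := th_log_bounds r s (t 0) (t 1) (t 2) hr' hs'
    a1 a2 a3 a4 a5 a6 x y z d c hx hy hz hd hc
  -- logarithms of the basic units
  have p1 : 0 < t 1 := by linarith
  have p2 : 0 < t 2 := by linarith
  have p3 : 0 < t 2 - r := by linarith
  have p4 : 0 < r - t 0 := by linarith
  have p5 : 0 < r - t 1 := by linarith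
  have p6 : 0 < s - t 0 := by linarith
  have l0 : Real.log (t 0) = -(x + y) := by
    have : Real.log (t 0 * t 1 * t 2) = 0 := by rw [e3, Real.log_one]
    rw [Real.log_mul (by positivity) (by positivity), Real.log_mul (by positivity) (by positivity)] at this
    linarith
  have m0 : Real.log (r - t 0) = x + d := by
    have k : (r - t 0) * (s - t 0) = t 1 * t 2 := by
      apply mul_left_cancel₀ a1.ne'
      linear_combination ht 0 - e3
    have k2 : r - t 0 = t 1 * (t 2 / (s - t 0)) := by
      field_simp; linarith
    rw [k2, Real.log_mul (by positivity) (by positivity)]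
  have m1 : Real.log (r - t 1) = -(x + d + z) := by
    have k : (r - t 0) * (r - t 1) * (t 2 - r) = 1 := by
      have h2 : (r : ℝ) ^ 3 - (t 0 + t 1 + t 2) * r ^ 2 + (t 0 * t 1 + t 0 * t 2 + t 1 * t 2) * r = 0 := by
        rw [e1, e2]; ring
      linear_combination e3 - h2
    have : Real.log ((r - t 0) * (r - t 1) * (t 2 - r)) = 0 := by rw [k, Real.log_one]
    rw [Real.log_mul (by positivity) (by positivity), Real.log_mul (by positivity) (by positivity)] at this
    linarith
  have n0 : Real.log (t 0 - r) = x + d := by rw [← Real.log_neg_eq_log, neg_sub, m0]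
  have n1 : Real.log (t 1 - r) = -(x + d + z) := by rw [← Real.log_neg_eq_log, neg_sub, m1]
  -- the unit
  have hnorm := hw.norm r s e1 e2 e3 ht
  have hne : ∀ i, w i ≠ 0 := by
    obtain ⟨P, Q, h⟩ := hw
    exact fun i => left_ne_zero_of_mul_eq_one (h i).2
  have hsum : Real.log (w 0) + Real.log (w 1) + Real.log (w 2) = 0 := by
    rw [← Real.log_mul (hne _) (hne _), ← Real.log_mul (mul_ne_zero (hne _) (hne _)) (hne _),
      ← Real.log_abs, hnorm, Real.log_one]
  set v0 := Real.log (w 0) with hv0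
  set v1 := Real.log (w 1) with hv1
  set v2 := Real.log (w 2) with hv2
  have hdet : 0 < (x + y) * (x + d + z) - x * (x + d) := by nlinarith
  obtain ⟨q1, q2, hq0, hq1⟩ : ∃ q1 q2 : ℝ, -(x + y) * q1 + (x + d) * q2 = v0 ∧
      x * q1 - (x + d + z) * q2 = v1 := by
    refine ⟨(-(x + d + z) * v0 - (x + d) * v1) / ((x + y) * (x + d + z) - x * (x + d)),
      (-x * v0 - (x + y) * v1) / ((x + y) * (x + d + z) - x * (x + d)), ?_, ?_⟩
    · rw [← mul_div_assoc, ← mul_div_assoc, ← add_div, div_eq_iff hdet.ne']; ring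
    · rw [← mul_div_assoc, ← mul_div_assoc, ← sub_div, div_eq_iff hdet.ne']; ring
  have hq2 : y * q1 + z * q2 = v2 := by linarith
  obtain ⟨m, n, hg⟩ := thomas_cover x y z d c q1 q2 b1.le b2.le b3 b4 b5 b6 b7 b8 b9
  have tne : ∀ i, t i ≠ 0 := by
    intro i h; have := ht i; rw [h] at this; norm_num at this
  have rne : ∀ i, t i - r ≠ 0 := by
    intro i h; have := ht i; rw [h] at this; norm_num at this
  have hU1 : thU t t := by
    refine ⟨Polynomial.X, (Polynomial.X - Polynomial.C r) * (Polynomial.X - Polynomial.C s), fun i => ⟨by simp, ?_⟩⟩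
    have := ht i
    simp; linarith
  have hU2 : thU t (fun i => t i - r) := by
    refine ⟨Polynomial.X - Polynomial.C r, Polynomial.X * (Polynomial.X - Polynomial.C s), fun i => ⟨by simp, ?_⟩⟩
    have := ht i
    simp; linarith
  have hW := (hw.mul (hU1.zpow m)).mul (hU2.zpow n)
  set W := w * t ^ m * (fun i => t i - (r : ℝ)) ^ n with hWdef
  have hWi : ∀ i, W i = w i * t i ^ m * (t i - r) ^ n := fun i => by simp [hWdef]
  have hWne : ∀ i, W i ≠ 0 := fun i => by
    rw [hWi]
    exact mul_ne_zero (mul_ne_zero (hne i) (zpow_ne_zero _ (tne i))) (zpow_ne_zero _ (rne i))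
  have hWlog : ∀ i, Real.log |W i| = Real.log (w i) + m * Real.log (t i) + n * Real.log (t i - r) := by
    intro i
    rw [Real.log_abs, hWi, Real.log_mul (mul_ne_zero (hne i) (zpow_ne_zero _ (tne i))) (zpow_ne_zero _ (rne i)),
      Real.log_mul (hne i) (zpow_ne_zero _ (tne i)), Real.log_zpow, Real.log_zpow]
  have L0 : Real.log |W 0| = thV1 x y d (q1 + m) (q2 + n) := by
    rw [hWlog, l0, n0, ← hv0, ← hq0]; unfold thV1; ring
  have L1 : Real.log |W 1| = thV2 x z d (q1 + m) (q2 + n) := by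
    rw [hWlog, n1, ← hv1, ← hx, ← hq1]; unfold thV2; ring
  have L2 : Real.log |W 2| = thV3 y z (q1 + m) (q2 + n) := by
    rw [hWlog, ← hv2, ← hy, ← hz, ← hq2]; unfold thV3; ring
  unfold thGood at hg
  rw [← L0, ← L1, ← L2] at hg
  simp only [abs_lt] at hg
  obtain ⟨⟨g1, g2⟩, ⟨g3, g4⟩, ⟨g5, g6⟩⟩ := hg
  have hD := th_disc (W 0) (W 1) (W 2) (hW.norm r s e1 e2 e3 ht) M
    (th_log_lt _ _ _ (hWne _) (hWne _) hM0 (by linarith))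
    (th_log_lt _ _ _ (hWne _) (hWne _) hM0 (by linarith))
    (th_log_lt _ _ _ (hWne _) (hWne _) hM0 (by linarith))
    (th_log_lt _ _ _ (hWne _) (hWne _) hM0 (by linarith))
    (th_log_lt _ _ _ (hWne _) (hWne _) hM0 (by linarith))
    (th_log_lt _ _ _ (hWne _) (hWne _) hM0 (by linarith))
  have h2M : 2 * M = |(t 0 - t 1) * (t 0 - t 2) * (t 1 - t 2)| := by
    rw [← abs_neg, show -((t 0 - t 1) * (t 0 - t 2) * (t 1 - t 2)) = 2 * M by rw [hM]; ring,
      abs_of_pos (by linarith)]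
  rw [h2M] at hD
  have hfin : ∀ (i : Fin 3) (e : ℝ), W i = e → w i = e * (t i ^ (-m) * (t i - r) ^ (-n)) := by
    intro i e h
    rw [← h, hWi, zpow_neg, zpow_neg]
    have := zpow_ne_zero m (tne i)
    have := zpow_ne_zero n (rne i)
    field_simp
  refine ⟨-m, -n, ?_⟩
  rcases hW.small r s hr hs e1 e2 e3 ht hD with h | h
  · left; intro i; rw [hfin i 1 (h i), one_mul]
  · right; intro i; rw [hfin i (-1) (h i), neg_one_mul]

/-- For integers `2 ≤ r ≤ s - 2` and `α` a real root of `X(X - r)(X - s) - 1`,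
the numbers `α` and `α - r` are units of the ring `ℤ[α]` (the subring of `ℝ`
generated by `α`), and every unit of `ℤ[α]` is of the form `± αᵃ (α - r)ᵇ`
with integers `a, b`. -/
theorem thomas_fundamental_units (r s : ℤ) (hr : 2 ≤ r) (hs : r ≤ s - 2) (α : ℝ)
    (hα : α * (α - (r : ℝ)) * (α - (s : ℝ)) - 1 = 0) :
    (∃ β ∈ Subring.closure {α}, α * β = 1) ∧
    ((α - (r : ℝ)) ∈ Subring.closure {α} ∧ ∃ β ∈ Subring.closure {α}, (α - (r : ℝ)) * β = 1) ∧
    ∀ u ∈ Subring.closure {α}, (∃ v ∈ Subring.closure {α}, u * v = 1) →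
      ∃ a b : ℤ, u = α ^ a * (α - (r : ℝ)) ^ b ∨ u = -(α ^ a * (α - (r : ℝ)) ^ b) := by
  have hmem : α ∈ Subring.closure {α} := Subring.subset_closure rfl
  have hmr : α - (r : ℝ) ∈ Subring.closure {α} := sub_mem hmem (intCast_mem _ r)
  have hms : α - (s : ℝ) ∈ Subring.closure {α} := sub_mem hmem (intCast_mem _ s)
  refine ⟨⟨_, mul_mem hmr hms, by linarith⟩, ⟨hmr, _, mul_mem hmem hms, by linarith⟩, ?_⟩
  rintro u hu ⟨v, hv, huv⟩
  have hr' : (2 : ℝ) ≤ r := by exact_mod_cast hr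
  have hs' : (r : ℝ) ≤ s - 2 := by exact_mod_cast hs
  obtain ⟨t0, t1, t2, ⟨h0, h1, h2⟩, a1, a2, a3, a4, a5, a6⟩ := th_roots r s hr' hs'
  obtain ⟨e1, e2, e3⟩ := th_vieta r s t0 t1 t2 h0 h1 h2
    (by intro h; linarith) (by intro h; linarith) (by intro h; linarith)
  have hprod : (α - t0) * (α - t1) * (α - t2) = 0 := by
    linear_combination hα - α ^ 2 * e1 + α * e2 - e3
  let t : Fin 3 → ℝ := ![t0, t1, t2]
  have ht : ∀ i, t i * (t i - r) * (t i - s) - 1 = 0 := by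
    intro i; fin_cases i
    · exact h0
    · exact h1
    · exact h2
  obtain ⟨j, hj⟩ : ∃ j, t j = α := by
    rcases mul_eq_zero.1 hprod with h | h
    · rcases mul_eq_zero.1 h with h | h
      · exact ⟨0, (sub_eq_zero.1 h).symm⟩
      · exact ⟨1, (sub_eq_zero.1 h).symm⟩
    · exact ⟨2, (sub_eq_zero.1 h).symm⟩
  subst hj
  obtain ⟨w, hw, rfl⟩ := thU_of_unit r s hr hs ht j u v hu hv huv
  obtain ⟨m, n, h⟩ := th_core r s hr hs t ht a1 a2 a3 a4 a5 a6 w hw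
  exact ⟨m, n, h.imp (fun h => h j) (fun h => h j)⟩
end

section
/- Let n ≥ 29 be an integer, let F_n be the n-th Fibonacci number, set G_1 = 0, G_2 = F_n, G_3 = 2^n, let α^(1) < α^(2) < α^(3) be the three real roots of f_n(X) = X·(X − F_n)·(X − 2^n) − 1, and set l_i^(k) = log|α^(k) − G_i| for i, k ∈ {1,2,3}. Let φ = (1+√5)/2. Then: (a) if i ≠ k and max{i,k} = 3, then |l_i^(k) − n·log 2| ≤ 0.81^n; (b) if i ≠ k and max{i,k} = 2, then |l_i^(k) − (n·log φ − log √5)| ≤ 2·0.81^n; (c) if i = k ∈ {1,2}, then |l_i^(k) + n·(log φ + log 2) − log √5| ≤ 3·0.81^n; (d) if i = k = 3, then |l_i^(k) + 2n·log 2| ≤ 2·0.81^n. -/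
lemma log_close (A Q d : ℝ) (hA : 0 < A) (hd : d ≤ A / 2) (h : |Q - A| ≤ d) :
    |Real.log Q - Real.log A| ≤ 2 * d / A := by
  obtain ⟨h1, h2⟩ := abs_le.mp h
  have hQ : A / 2 ≤ Q := by linarith
  have hQ0 : 0 < Q := by linarith
  have hd0 : 0 ≤ d := le_trans (abs_nonneg _) h
  have e1 := Real.log_le_sub_one_of_pos (div_pos hQ0 hA)
  have e2 := Real.log_le_sub_one_of_pos (div_pos hA hQ0)
  rw [Real.log_div hQ0.ne' hA.ne'] at e1
  rw [Real.log_div hA.ne' hQ0.ne'] at e2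
  have b1 : Q / A - 1 ≤ 2 * d / A := by
    rw [div_sub_one hA.ne']
    gcongr
    linarith
  have b2 : A / Q - 1 ≤ 2 * d / A := by
    rw [div_sub_one hQ0.ne', div_le_div_iff₀ hQ0 hA]
    nlinarith
  rw [abs_le]
  constructor <;> linarith

lemma fib_upper (n : ℕ) : 2 * (Nat.fib (n + 2) : ℝ) ≤ (1.62 : ℝ) ^ (n + 2) ∧
    2 * (Nat.fib (n + 3) : ℝ) ≤ (1.62 : ℝ) ^ (n + 3) := by
  induction n with
  | zero => norm_num [Nat.fib_add_two]
  | succ k ih =>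
    refine ⟨ih.2, ?_⟩
    have e : Nat.fib (k + 1 + 3) = Nat.fib (k + 2) + Nat.fib (k + 3) := Nat.fib_add_two
    rw [e]
    push_cast
    have hp : (0 : ℝ) < 1.62 ^ (k + 2) := by positivity
    have e1 : (1.62 : ℝ) ^ (k + 3) = 1.62 ^ (k + 2) * 1.62 := pow_succ _ _
    have e2 : (1.62 : ℝ) ^ (k + 1 + 3) = 1.62 ^ (k + 2) * 1.62 * 1.62 := by
      rw [← pow_succ, ← pow_succ]
    rw [e2]
    rw [e1] at ih
    nlinarith [ih.1, ih.2]

lemma fib_approx (n : ℕ) :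
    |(Nat.fib n : ℝ) - ((1 + Real.sqrt 5) / 2) ^ n / Real.sqrt 5| ≤ 1 / 2 := by
  have h5 : (2 : ℝ) ≤ Real.sqrt 5 := Real.le_sqrt_of_sq_le (by norm_num)
  have h5' : Real.sqrt 5 ≤ 3 := by
    rw [Real.sqrt_le_left (by norm_num)]; norm_num
  have hc := Real.coe_fib_eq n
  rw [hc]
  have : ((1 + Real.sqrt 5) / 2) ^ n / Real.sqrt 5 = Real.goldenRatio ^ n / Real.sqrt 5 := rfl
  rw [this, sub_div, sub_sub_cancel_left, abs_neg, abs_div, abs_pow,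
    abs_of_nonneg (Real.sqrt_nonneg 5)]
  have hq : |Real.goldenConj| ≤ 1 := by
    unfold Real.goldenConj
    rw [abs_le]; constructor <;> linarith
  have hp : |Real.goldenConj| ^ n ≤ 1 := pow_le_one₀ (abs_nonneg _) hq
  rw [div_le_div_iff₀ (by linarith) (by norm_num)]
  linarith

lemma pow_ge_of_base (c : ℝ) (hc : 1 ≤ c) (n : ℕ) (hn : 29 ≤ n) : c ^ 29 ≤ c ^ n :=
  pow_le_pow_right₀ hc hn

/-- Localisation of the three roots. -/
lemma root_loc (F T a b c : ℝ) (hF : 5 ≤ F) (hT : 4 * F ≤ T) (hab : a < b) (hbc : b < c)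
    (ha : a * (a - F) * (a - T) - 1 = 0) (hb : b * (b - F) * (b - T) - 1 = 0)
    (hc : c * (c - F) * (c - T) - 1 = 0) :
    0 < a ∧ a * T ≤ 1 ∧ b < F ∧ (F - b) * T ≤ 2 ∧ T < c ∧ (c - T) * T ≤ 1 := by
  have loc : ∀ x : ℝ, x * (x - F) * (x - T) - 1 = 0 → 0 < x ∧ (x < F ∨ T < x) := by
    intro x hx
    have hx0 : 0 < x := by
      by_contra h
      push Not at h
      have : 0 ≤ (F - x) * (T - x) := mul_nonneg (by linarith) (by linarith)
      nlinarith
    refine ⟨hx0, ?_⟩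
    by_contra h
    push Not at h
    have : 0 ≤ x * (x - F) * (T - x) :=
      mul_nonneg (mul_nonneg hx0.le (by linarith)) (by linarith)
    nlinarith
  have q1 : a^2 + a*b + b^2 - (F+T)*(a+b) + F*T = 0 := by
    have : (b - a) * (a^2 + a*b + b^2 - (F+T)*(a+b) + F*T) = 0 := by linear_combination hb - ha
    rcases mul_eq_zero.mp this with h | h
    · linarith
    · exact h
  have q2 : a^2 + a*c + c^2 - (F+T)*(a+c) + F*T = 0 := by
    have : (c - a) * (a^2 + a*c + c^2 - (F+T)*(a+c) + F*T) = 0 := by linear_combination hc - ha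
    rcases mul_eq_zero.mp this with h | h
    · linarith
    · exact h
  have hs : a + b + c = F + T := by
    have : (c - b) * (a + b + c - (F + T)) = 0 := by linear_combination q2 - q1
    rcases mul_eq_zero.mp this with h | h
    · linarith
    · linarith
  obtain ⟨a0, ha'⟩ := loc a ha
  obtain ⟨b0, hb'⟩ := loc b hb
  obtain ⟨c0, hc'⟩ := loc c hc
  have cT : T < c := by
    rcases hc' with h | h
    · linarith
    · exact h
  have bF : b < F := by
    rcases hb' with h | h
    · exact h
    · linarith
  have h1 : (c - T) * T ≤ 1 := by
    have k1 : T ≤ c * (c - F) := by nlinarith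
    nlinarith [mul_le_mul_of_nonneg_left k1 (sub_pos.mpr cT).le]
  have h2 : a * T ≤ 1 := by
    have k1 : T ≤ (F - a) * (T - a) := by
      have : 2 ≤ F - a := by linarith
      have : T / 2 ≤ T - a := by linarith
      nlinarith
    nlinarith [mul_le_mul_of_nonneg_left k1 a0.le]
  refine ⟨a0, h2, bF, ?_, cT, h1⟩
  have : F - b = (c - T) + a := by linarith
  rw [this]
  linarith

/-- Estimates for `l i k = log |α⁽ᵏ⁾ - Gᵢ|`, where `α⁽¹⁾ < α⁽²⁾ < α⁽³⁾` are the
three real roots of `fₙ(X) = X(X - Fₙ)(X - 2ⁿ) - 1` and `G₁ = 0`, `G₂ = Fₙ`,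
`G₃ = 2ⁿ` (indices shifted to `0, 1, 2`).  With `φ = (1 + √5)/2`:
(a) if `i ≠ k` and `max i k` is the last index, `|l i k - n log 2| ≤ 0.81ⁿ`;
(b) if `i ≠ k` and `max i k` is the middle index,
    `|l i k - (n log φ - log √5)| ≤ 2·0.81ⁿ`;
(c) if `i = k` is one of the first two indices,
    `|l i i + n(log φ + log 2) - log √5| ≤ 3·0.81ⁿ`;
(d) `|l 2 2 + 2n log 2| ≤ 2·0.81ⁿ`. -/
theorem lik_estimates (n : ℕ) (hn : 29 ≤ n)
    (G α : Fin 3 → ℝ)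
    (hG : G = ![0, (Nat.fib n : ℝ), 2 ^ n])
    (hord : α 0 < α 1 ∧ α 1 < α 2)
    (hroot : ∀ i, α i * (α i - (Nat.fib n : ℝ)) * (α i - 2 ^ n) - 1 = 0)
    (l : Fin 3 → Fin 3 → ℝ)
    (hl : ∀ i k, l i k = Real.log |α k - G i|) :
    (∀ i k : Fin 3, i ≠ k → max i k = 2 →
      |l i k - (n : ℝ) * Real.log 2| ≤ (0.81 : ℝ) ^ n) ∧
    (∀ i k : Fin 3, i ≠ k → max i k = 1 →
      |l i k - ((n : ℝ) * Real.log ((1 + Real.sqrt 5) / 2) - Real.log (Real.sqrt 5))| ≤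
        2 * (0.81 : ℝ) ^ n) ∧
    (∀ i : Fin 3, i = 0 ∨ i = 1 →
      |l i i + (n : ℝ) * (Real.log ((1 + Real.sqrt 5) / 2) + Real.log 2) -
          Real.log (Real.sqrt 5)| ≤ 3 * (0.81 : ℝ) ^ n) ∧
    |l 2 2 + 2 * (n : ℝ) * Real.log 2| ≤ 2 * (0.81 : ℝ) ^ n := by
  obtain ⟨hab, hbc⟩ := hord
  have h29 : (514229 : ℝ) ≤ (Nat.fib n : ℝ) := by
    have h := Nat.fib_mono hn
    have h' : Nat.fib 29 = 514229 := by norm_num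
    rw [h'] at h
    exact_mod_cast h
  have hT2 : (1000 : ℝ) ≤ 2 ^ n := by
    have := pow_ge_of_base 2 (by norm_num) n hn
    norm_num at this
    linarith
  have hFup : 2 * (Nat.fib n : ℝ) ≤ (1.62 : ℝ) ^ n := by
    obtain ⟨m, rfl⟩ : ∃ m, n = m + 2 := ⟨n - 2, by omega⟩
    exact (fib_upper m).1
  have hmul : (1.62 : ℝ) ^ n = 2 ^ n * 0.81 ^ n := by
    rw [← mul_pow]; norm_num
  have heps : (0.81 : ℝ) ^ n ≤ 1 / 4 := by
    have h : (0.81 : ℝ) ^ n ≤ 0.81 ^ 29 :=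
      pow_le_pow_of_le_one (by norm_num) (by norm_num) hn
    refine h.trans (by norm_num)
  have hFT : 2 * (Nat.fib n : ℝ) ≤ 2 ^ n * 0.81 ^ n := hmul ▸ hFup
  have hA1 := fib_approx n
  have h5 : (2.2 : ℝ) ≤ Real.sqrt 5 := Real.le_sqrt_of_sq_le (by norm_num)
  have h5' : Real.sqrt 5 ≤ 3 := by
    rw [Real.sqrt_le_left (by norm_num)]; norm_num
  have hApos : 0 < ((1 + Real.sqrt 5) / 2) ^ n / Real.sqrt 5 := by positivity
  have hlogA : Real.log (((1 + Real.sqrt 5) / 2) ^ n / Real.sqrt 5) =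
      (n : ℝ) * Real.log ((1 + Real.sqrt 5) / 2) - Real.log (Real.sqrt 5) := by
    rw [Real.log_div (by positivity) (by positivity), Real.log_pow]
  have hAeps : 1 ≤ ((1 + Real.sqrt 5) / 2) ^ n / Real.sqrt 5 * 0.81 ^ n := by
    have h1 : (1.6 : ℝ) ^ n ≤ ((1 + Real.sqrt 5) / 2) ^ n :=
      pow_le_pow_left₀ (by norm_num) (by linarith) n
    have h2 : (1.296 : ℝ) ^ n = 1.6 ^ n * 0.81 ^ n := by
      rw [← mul_pow]; norm_num
    have h3 : (3 : ℝ) ≤ 1.296 ^ n := by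
      have := pow_ge_of_base 1.296 (by norm_num) n hn
      refine le_trans ?_ this
      norm_num
    have h4 : (1.6 : ℝ) ^ n * 0.81 ^ n ≤ ((1 + Real.sqrt 5) / 2) ^ n * 0.81 ^ n := by gcongr
    rw [div_mul_eq_mul_div, le_div_iff₀ (by linarith)]
    linarith
  rw [← hlogA]
  have hc_rw : ∀ x : ℝ, x + (n : ℝ) * (Real.log ((1 + Real.sqrt 5) / 2) + Real.log 2) -
          Real.log (Real.sqrt 5) =
        x + Real.log (((1 + Real.sqrt 5) / 2) ^ n / Real.sqrt 5) + (n : ℝ) * Real.log 2 := by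
    intro x; rw [hlogA]; ring
  have hlogT : Real.log ((2 : ℝ) ^ n) = (n : ℝ) * Real.log 2 := Real.log_pow _ _
  have hsum : ∀ k, l 0 k + l 1 k + l 2 k = 0 := by
    intro k
    have h := hroot k
    have hp : α k * (α k - (Nat.fib n : ℝ)) * (α k - 2 ^ n) = 1 := by linarith
    have n1 : α k ≠ 0 := by intro h0; rw [h0] at hp; norm_num at hp
    have n2 : α k - (Nat.fib n : ℝ) ≠ 0 := by intro h0; rw [h0] at hp; norm_num at hp
    have n3 : α k - 2 ^ n ≠ 0 := by intro h0; rw [h0] at hp; norm_num at hp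
    have := congrArg Real.log hp
    rw [Real.log_mul (mul_ne_zero n1 n2) n3, Real.log_mul n1 n2, Real.log_one] at this
    simpa [hl, hG, Real.log_abs] using this
  simp only [hc_rw, mul_assoc (2 : ℝ), ← hlogT]
  obtain ⟨a0, aT, bF, bT, cT, cT'⟩ := root_loc (Nat.fib n) (2 ^ n) (α 0) (α 1) (α 2)
    (by linarith) (by nlinarith) hab hbc (hroot 0) (hroot 1) (hroot 2)
  generalize hA : ((1 + Real.sqrt 5) / 2) ^ n / Real.sqrt 5 = A at *
  have l0 : ∀ k, l 0 k = Real.log (α k) := by intro k; simp [hl, hG, Real.log_abs]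
  have l1 : ∀ k, l 1 k = Real.log (α k - Nat.fib n) := by intro k; simp [hl, hG, Real.log_abs]
  have l1' : ∀ k, l 1 k = Real.log (Nat.fib n - α k) := by
    intro k; rw [l1, ← Real.log_neg_eq_log, neg_sub]
  have l2 : ∀ k, l 2 k = Real.log (2 ^ n - α k) := by
    intro k; rw [hl, abs_sub_comm]; simp [hG, Real.log_abs]
  generalize (Nat.fib n : ℝ) = F at *
  generalize (0.81 : ℝ) ^ n = e at *
  generalize (2 : ℝ) ^ n = T at *
  have hT0 : 0 < T := by linarith
  have a1 : α 0 ≤ 1 / 4 := by nlinarith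
  have b1 : F - α 1 ≤ 1 / 4 := by nlinarith
  have c1 : α 2 - T ≤ 1 / 4 := by nlinarith
  have TF : F ≤ T / 2 := by nlinarith
  have key : ∀ Q, |Q - T| ≤ F → |Real.log Q - Real.log T| ≤ e := by
    intro Q hQ
    refine (log_close T Q F hT0 TF hQ).trans ?_
    rw [div_le_iff₀ hT0]; linarith
  have key2 : ∀ Q, |Q - F| ≤ 1 / 4 → |Real.log Q - Real.log A| ≤ 2 * e := by
    intro Q hQ
    rw [abs_le] at hA1 hQ
    have hQ' : |Q - A| ≤ 1 := by
      rw [abs_le]; constructor <;> linarith [hA1.1, hA1.2, hQ.1, hQ.2]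
    refine (log_close A Q 1 hApos (by linarith [hA1.2]) hQ').trans ?_
    rw [div_le_iff₀ hApos]; linarith
  have A02 : |l 0 2 - Real.log T| ≤ e := by
    rw [l0]; apply key; rw [abs_le]; constructor <;> linarith
  have A12 : |l 1 2 - Real.log T| ≤ e := by
    rw [l1]; apply key; rw [abs_le]; constructor <;> linarith
  have A20 : |l 2 0 - Real.log T| ≤ e := by
    rw [l2]; apply key; rw [abs_le]; constructor <;> linarith
  have A21 : |l 2 1 - Real.log T| ≤ e := by
    rw [l2]; apply key; rw [abs_le]; constructor <;> linarith
  have B01 : |l 0 1 - Real.log A| ≤ 2 * e := by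
    rw [l0]; apply key2; rw [abs_le]; constructor <;> linarith
  have B10 : |l 1 0 - Real.log A| ≤ 2 * e := by
    rw [l1']; apply key2; rw [abs_le]; constructor <;> linarith
  have s0 := hsum 0
  have s1 := hsum 1
  have s2 := hsum 2
  refine ⟨?_, ?_, ?_, ?_⟩
  · intro i k hik hm
    fin_cases i <;> fin_cases k <;> first | exact A02 | exact A12 | exact A20 | exact A21 | exact absurd rfl hik | exact absurd hm (by decide)
  · intro i k hik hm
    fin_cases i <;> fin_cases k <;> first | exact B01 | exact B10 | exact absurd rfl hik | exact absurd hm (by decide)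
  · rw [abs_le] at *
    rintro i (rfl | rfl) <;> rw [abs_le] <;> constructor <;> linarith [A20.1, A20.2, A21.1, A21.2, B01.1, B01.2, B10.1, B10.2]
  · rw [abs_le] at *
    constructor <;> linarith [A02.1, A02.2, A12.1, A12.2]
end

section
/- Let n ≥ 29 be an integer, let F_n be the n-th Fibonacci number, let α^(1) < α^(2) < α^(3) be the three real roots of f_n(X) = X·(X − F_n)·(X − 2^n) − 1, let (x, y) be an integer solution of x·(x − F_n·y)·(x − 2^n·y) − y³ = ±1 with |y| ≥ 2, set β^(i) = x − α^(i)·y, and let j ∈ {1,2,3} be such that |β^(j)| = min{|β^(1)|, |β^(2)|, |β^(3)|}. Suppose u_1 and u_2 are integers such that |β^(i)| = |α^(i)|^{u_1} · |α^(i) − F_n|^{u_2} holds for every i ∈ {1,2,3} with i ≠ j. Then max{|u_1|, |u_2|} < 2·log|y|/n + 2. -/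
namespace ExpBound

lemma fib_bounds (n : ℕ) (hn : 29 ≤ n) :
    2 ^ n ≤ Nat.fib n ^ 2 ∧ 100 * Nat.fib n ≤ 2 ^ n * 10 ∧ 1000 ≤ Nat.fib n := by
  have key : ∀ k : ℕ, (2 ^ (29 + k) ≤ Nat.fib (29 + k) ^ 2 ∧
      100 * Nat.fib (29 + k) ≤ 2 ^ (29 + k) * 10 ∧ 1000 ≤ Nat.fib (29 + k)) ∧
      (2 ^ (29 + (k + 1)) ≤ Nat.fib (29 + (k + 1)) ^ 2 ∧
      100 * Nat.fib (29 + (k + 1)) ≤ 2 ^ (29 + (k + 1)) * 10 ∧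
      1000 ≤ Nat.fib (29 + (k + 1))) := by
    intro k
    induction k with
    | zero => simp [Nat.fib]
    | succ k ih =>
      refine ⟨ih.2, ?_⟩
      obtain ⟨⟨h1, h2, h3⟩, h4, h5, h6⟩ := ih
      have e : Nat.fib (29 + (k + 1 + 1)) = Nat.fib (29 + k) + Nat.fib (29 + (k + 1)) :=
        Nat.fib_add_two
      have hm : Nat.fib (29 + k) ≤ Nat.fib (29 + (k + 1)) := Nat.fib_mono (by omega)
      have p1 : 2 ^ (29 + (k + 1)) = 2 * 2 ^ (29 + k) := by ring
      have p2 : 2 ^ (29 + (k + 1 + 1)) = 4 * 2 ^ (29 + k) := by ring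
      rw [e, p2]
      rw [p1] at h4 h5
      generalize 2 ^ (29 + k) = T at *
      refine ⟨?_, by omega, by omega⟩
      nlinarith
  obtain ⟨k, rfl⟩ := Nat.exists_eq_add_of_le hn
  exact (key k).1

lemma root_loc (F T a : ℝ) (hF : 1000 ≤ F) (hT : 10 * F ≤ T) (h : a * (a - F) * (a - T) - 1 = 0) :
    (0 < a ∧ a < 1) ∨ (F - 1 < a ∧ a < F) ∨ (T < a ∧ a < T + 1) := by
  rcases lt_or_ge T a with h1 | h1
  · right; right
    refine ⟨h1, ?_⟩
    by_contra hc
    push Not at hc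
    have : 1 * 1 * 1 < a * (a - F) * (a - T) := by
      have : 1 * 1 < a * (a - F) := by nlinarith
      nlinarith
    linarith
  · have hT1 : a ≠ T := by rintro rfl; simp at h
    have h1 : a < T := lt_of_le_of_ne h1 hT1
    have hneg : a * (a - F) < 0 := by
      by_contra hc; push Not at hc
      nlinarith [mul_nonneg hc (sub_nonneg.2 h1.le)]
    have h0 : 0 < a := by
      by_contra hc; push Not at hc
      nlinarith [mul_nonneg (neg_nonneg.2 hc) (by linarith : 0 ≤ F - a)]
    have hF1 : a < F := by nlinarith
    by_contra hc
    push Not at hc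
    obtain ⟨c1, c2, c3⟩ := hc
    have b1 : 1 ≤ a := c1 h0
    have b2 : a ≤ F - 1 := by
      by_contra h'; push Not at h'; linarith [c2 h']
    have : 1 ≤ a * (F - a) := by nlinarith
    nlinarith

lemma roots_loc (F T : ℝ) (hF : 1000 ≤ F) (hT : 10 * F ≤ T) (a b c : ℝ) (hab : a < b) (hbc : b < c)
    (ha : a * (a - F) * (a - T) - 1 = 0) (hb : b * (b - F) * (b - T) - 1 = 0)
    (hc : c * (c - F) * (c - T) - 1 = 0) :
    (0 < a ∧ a < 1) ∧ (F - 1 < b ∧ b < F) ∧ (T < c ∧ c < T + 1) := by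
  have quad : ∀ u v : ℝ, u < v → u * (u - F) * (u - T) - 1 = 0 → v * (v - F) * (v - T) - 1 = 0 →
      u ^ 2 + u * v + v ^ 2 - (F + T) * (u + v) + F * T = 0 := by
    intro u v huv hu hv
    have : (v - u) * (u ^ 2 + u * v + v ^ 2 - (F + T) * (u + v) + F * T) = 0 := by
      linear_combination hv - hu
    rcases mul_eq_zero.1 this with h | h
    · linarith
    · exact h
  have n1 : ∀ u v : ℝ, u < v → u * (u - F) * (u - T) - 1 = 0 → v * (v - F) * (v - T) - 1 = 0 →
      0 < u → v < 1 → False := by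
    intro u v huv hu hv h1 h2
    nlinarith [quad u v huv hu hv, mul_pos h1 (h1.trans huv)]
  have n2 : ∀ u v : ℝ, u < v → u * (u - F) * (u - T) - 1 = 0 → v * (v - F) * (v - T) - 1 = 0 →
      F - 1 < u → v < F → False := by
    intro u v huv hu hv h1 h2
    have q := quad u v huv hu hv
    have : u ^ 2 + u * v + v ^ 2 ≤ 3 * F ^ 2 := by nlinarith
    nlinarith
  have n3 : ∀ u v : ℝ, u < v → u * (u - F) * (u - T) - 1 = 0 → v * (v - F) * (v - T) - 1 = 0 →
      T < u → False := by
    intro u v huv hu hv h1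
    have q := quad u v huv hu hv
    nlinarith [mul_pos (sub_pos.2 h1) (sub_pos.2 (h1.trans huv))]
  rcases root_loc F T a hF hT ha with h1 | h1 | h1 <;>
  rcases root_loc F T b hF hT hb with h2 | h2 | h2 <;>
  rcases root_loc F T c hF hT hc with h3 | h3 | h3 <;>
  first
  | exact ⟨h1, h2, h3⟩
  | (exfalso; linarith [h1.1, h1.2, h2.1, h2.2, h3.1, h3.2])
  | exact (n1 _ _ hab ha hb h1.1 h2.2).elim
  | exact (n1 _ _ hbc hb hc h2.1 h3.2).elim
  | exact (n2 _ _ hab ha hb h1.1 h2.2).elim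
  | exact (n2 _ _ hbc hb hc h2.1 h3.2).elim
  | exact (n3 _ _ hab ha hb h1.1).elim
  | exact (n3 _ _ hbc hb hc h2.1).elim

lemma vieta (F T a b c X Y : ℝ) (hab : a < b) (hbc : b < c)
    (ha : a * (a - F) * (a - T) - 1 = 0) (hb : b * (b - F) * (b - T) - 1 = 0)
    (hc : c * (c - F) * (c - T) - 1 = 0) :
    (X - a * Y) * (X - b * Y) * (X - c * Y) = X * (X - F * Y) * (X - T * Y) - Y ^ 3 := by
  have q1 : a ^ 2 + a * b + b ^ 2 - (F + T) * (a + b) + F * T = 0 := by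
    apply mul_left_cancel₀ (sub_ne_zero.2 hab.ne')
    linear_combination hb - ha
  have q2 : b ^ 2 + b * c + c ^ 2 - (F + T) * (b + c) + F * T = 0 := by
    apply mul_left_cancel₀ (sub_ne_zero.2 hbc.ne')
    linear_combination hc - hb
  have s1 : a + b + c - (F + T) = 0 := by
    apply mul_left_cancel₀ (sub_ne_zero.2 (hab.trans hbc).ne')
    linear_combination q2 - q1
  have hs : c = F + T - a - b := by linarith
  have s2 : a * b + b * c + a * c = F * T := by
    rw [hs]; linear_combination -q1
  have s3 : a * b * c = 1 := by
    linear_combination ha + a * s2 - a ^ 2 * s1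
  linear_combination (-X ^ 2 * Y) * s1 + X * Y ^ 2 * s2 - Y ^ 3 * s3

lemma log_near (z w : ℝ) (hw : 0 < w) (h1 : w / 2 ≤ z) (h2 : z ≤ 2 * w) :
    |Real.log z - Real.log w| ≤ Real.log 2 := by
  have hz : 0 < z := by linarith
  have a1 := Real.log_le_log (by positivity) h1
  have a2 := Real.log_le_log hz h2
  rw [Real.log_div hw.ne' two_ne_zero] at a1
  rw [Real.log_mul two_ne_zero hw.ne'] at a2
  rw [abs_le]; constructor <;> linarith

lemma log_near4 (z w : ℝ) (hw : 0 < w) (h1 : w / 4 ≤ z) (h2 : z ≤ 4 * w) :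
    |Real.log z - Real.log w| ≤ 2 * Real.log 2 := by
  have hz : 0 < z := by linarith
  have a1 := Real.log_le_log (by positivity) h1
  have a2 := Real.log_le_log hz h2
  have e : Real.log 4 = 2 * Real.log 2 := by
    rw [show (4 : ℝ) = 2 ^ 2 by norm_num, Real.log_pow]; norm_num
  rw [Real.log_div hw.ne' (by norm_num), e] at a1
  rw [Real.log_mul (by norm_num) hw.ne', e] at a2
  rw [abs_le]; constructor <;> linarith

/-- Replace perturbed coefficients by the model ones. -/
lemma perturb (u v U p q p' q' L L' l : ℝ) (hu : |u| ≤ U) (hv : |v| ≤ U)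
    (hp : |p - p'| ≤ l) (hq : |q - q'| ≤ l) (hL : |L - L'| ≤ 2 * l) (h : u * p + v * q = L) :
    |u * p' + v * q' - L'| ≤ l * (2 + 2 * U) := by
  have e : u * p' + v * q' - L' = (L - L') + (-(u * (p - p')) + -(v * (q - q'))) := by
    linear_combination h
  have b1 : |u * (p - p')| ≤ U * l := by
    rw [abs_mul]; exact mul_le_mul hu hp (abs_nonneg _) ((abs_nonneg _).trans hu)
  have b2 : |v * (q - q')| ≤ U * l := by
    rw [abs_mul]; exact mul_le_mul hv hq (abs_nonneg _) ((abs_nonneg _).trans hv)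
  rw [e]
  have := abs_add_le (L - L') (-(u * (p - p')) + -(v * (q - q')))
  have := abs_add_le (-(u * (p - p'))) (-(v * (q - q')))
  rw [abs_neg, abs_neg] at this
  linarith

lemma finish (N Y l U : ℝ) (hN : 29 ≤ N) (hY : 0 ≤ Y) (hl : 0.6931 < l) (hU : 0 ≤ U)
    (h : U * (N * l) ≤ 1.25 * Y + N * l + 1.25 * (l * (2 + 2 * U))) : U < 2 * Y / N + 2 := by
  have hN0 : 0 < N := by linarith
  by_contra hc
  push Not at hc
  have h1 : 2 * Y + 2 * N ≤ U * N := by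
    have := mul_le_mul_of_nonneg_right hc hN0.le
    have e : (2 * Y / N + 2) * N = 2 * Y + 2 * N := by field_simp
    linarith
  have h29 : 29 * U ≤ U * N := by nlinarith
  have h2 : U * N * (1 - 2.5 / 29) ≤ U * N - 2.5 * U := by linarith
  have h3 : l * (U * N - 2.5 * U - N - 2.5) ≤ 1.25 * Y := by linarith
  have h4 : (2 * Y + 2 * N) * (1 - 2.5 / 29) - N - 2.5 ≤ U * N - 2.5 * U - N - 2.5 := by linarith
  have h5 : 0 ≤ (2 * Y + 2 * N) * (1 - 2.5 / 29) - N - 2.5 := by linarith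
  have h6 : 0.6931 * ((2 * Y + 2 * N) * (1 - 2.5 / 29) - N - 2.5)
      ≤ l * (U * N - 2.5 * U - N - 2.5) := by
    exact mul_le_mul hl.le h4 h5 (by linarith)
  linarith

lemma coreA (A t Y E u v : ℝ) (ht : 0 < t) (hA1 : t / 2 ≤ A) (hA2 : A ≤ t)
    (hY : 0 ≤ Y) (h1 : |u * A + v * (-(A + t)) - (Y + A)| ≤ E)
    (h2 : |u * t + v * t - (Y + t)| ≤ E) :
    |u| * t ≤ 1.25 * Y + t + 1.25 * E ∧ |v| * t ≤ 1.25 * Y + t + 1.25 * E := by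
  have hE : 0 ≤ E := (abs_nonneg _).trans h1
  obtain ⟨E1, hE1⟩ : ∃ e, e = u * A + v * (-(A + t)) - (Y + A) := ⟨_, rfl⟩
  obtain ⟨E2, hE2⟩ : ∃ e, e = u * t + v * t - (Y + t) := ⟨_, rfl⟩
  rw [← hE1, abs_le] at h1
  rw [← hE2, abs_le] at h2
  have hD : 0 < 2 * A + t := by linarith
  have eu : (u * t) * (2 * A + t) = Y * (A + 2 * t) + t * (2 * A + t) + (A + t) * E2 + t * E1 := by
    rw [hE1, hE2]; ring
  have ev : (v * t) * (2 * A + t) = Y * (A - t) + A * E2 - t * E1 := by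
    rw [hE1, hE2]; ring
  have k : ∀ Z : ℝ, 0 ≤ Z → Z * (A + 2 * t) ≤ 1.25 * Z * (2 * A + t) := by
    intro Z hZ
    nlinarith [mul_nonneg hZ (by linarith : 0 ≤ A - t / 2)]
  have kY := k Y hY
  have kE := k E hE
  have hA : 0 < A := by linarith
  have b1 : (A + t) * E2 ≤ (A + t) * E := mul_le_mul_of_nonneg_left h2.2 (by linarith)
  have b2 : (A + t) * (-E) ≤ (A + t) * E2 := mul_le_mul_of_nonneg_left h2.1 (by linarith)
  have b3 : t * E1 ≤ t * E := mul_le_mul_of_nonneg_left h1.2 ht.le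
  have b4 : t * (-E) ≤ t * E1 := mul_le_mul_of_nonneg_left h1.1 ht.le
  have b5 : A * E2 ≤ A * E := mul_le_mul_of_nonneg_left h2.2 (by linarith)
  have b6 : A * (-E) ≤ A * E2 := mul_le_mul_of_nonneg_left h2.1 (by linarith)
  have c1 := mul_nonneg hY hA.le
  have c2 := mul_nonneg hY ht.le
  have c3 := mul_nonneg hE hA.le
  have c4 := mul_nonneg hE ht.le
  have c5 := mul_pos ht hD
  rw [← abs_of_pos ht, ← abs_mul, ← abs_mul, abs_of_pos ht, abs_le, abs_le]
  refine ⟨⟨?_, ?_⟩, ?_, ?_⟩ <;> refine le_of_mul_le_mul_right ?_ hD <;> nlinarith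

lemma coreB (A t Y E u v : ℝ) (ht : 0 < t) (hA1 : t / 2 ≤ A)
    (hY : 0 ≤ Y) (h1 : |u * A + v * (-(A + t)) - (Y + t)| ≤ E)
    (h2 : |u * (-(A + t)) + v * A - (Y + t)| ≤ E) :
    |u| * t ≤ 1.25 * Y + t + 1.25 * E ∧ |v| * t ≤ 1.25 * Y + t + 1.25 * E := by
  have hE : 0 ≤ E := (abs_nonneg _).trans h1
  obtain ⟨E1, hE1⟩ : ∃ e, e = u * A + v * (-(A + t)) - (Y + t) := ⟨_, rfl⟩
  obtain ⟨E2, hE2⟩ : ∃ e, e = u * (-(A + t)) + v * A - (Y + t) := ⟨_, rfl⟩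
  rw [← hE1, abs_le] at h1
  rw [← hE2, abs_le] at h2
  have hD : 0 < 2 * A + t := by linarith
  have hA : 0 < A := by linarith
  have eu : (u * t) * (2 * A + t) = -((Y + t) * (2 * A + t)) - A * E1 - (A + t) * E2 := by
    rw [hE1, hE2]; ring
  have ev : (v * t) * (2 * A + t) = -((Y + t) * (2 * A + t)) - A * E2 - (A + t) * E1 := by
    rw [hE1, hE2]; ring
  have b1 : (A + t) * E2 ≤ (A + t) * E := mul_le_mul_of_nonneg_left h2.2 (by linarith)
  have b2 : (A + t) * (-E) ≤ (A + t) * E2 := mul_le_mul_of_nonneg_left h2.1 (by linarith)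
  have b3 : (A + t) * E1 ≤ (A + t) * E := mul_le_mul_of_nonneg_left h1.2 (by linarith)
  have b4 : (A + t) * (-E) ≤ (A + t) * E1 := mul_le_mul_of_nonneg_left h1.1 (by linarith)
  have b5 : A * E2 ≤ A * E := mul_le_mul_of_nonneg_left h2.2 hA.le
  have b6 : A * (-E) ≤ A * E2 := mul_le_mul_of_nonneg_left h2.1 hA.le
  have b7 : A * E1 ≤ A * E := mul_le_mul_of_nonneg_left h1.2 hA.le
  have b8 : A * (-E) ≤ A * E1 := mul_le_mul_of_nonneg_left h1.1 hA.le
  have c1 := mul_nonneg hY hA.le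
  have c2 := mul_nonneg hY ht.le
  have c3 := mul_nonneg hE hA.le
  have c4 := mul_nonneg hE ht.le
  have c5 := mul_pos ht hD
  rw [← abs_of_pos ht, ← abs_mul, ← abs_mul, abs_of_pos ht, abs_le, abs_le]
  refine ⟨⟨?_, ?_⟩, ?_, ?_⟩ <;> refine le_of_mul_le_mul_right ?_ hD <;> nlinarith

/-- Size of `β i` for `i ≠ j`. -/
lemma beta_log (x y a b G : ℝ) (hy : 2 ≤ |y|) (hG : 100 ≤ G) (hj : |x - b * y| ≤ 1)
    (h1 : G / 2 ≤ |a - b|) (h2 : |a - b| ≤ 2 * G) :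
    |Real.log |x - a * y| - (Real.log |y| + Real.log G)| ≤ 2 * Real.log 2 := by
  have e : x - a * y = (x - b * y) - (a - b) * y := by ring
  have u1 : |x - a * y| ≤ |x - b * y| + |(a - b) * y| := by rw [e]; exact abs_sub _ _
  have u2 : |(a - b) * y| ≤ |x - b * y| + |x - a * y| := by
    have : (a - b) * y = (x - b * y) - (x - a * y) := by ring
    rw [this]; exact abs_sub _ _
  rw [abs_mul] at u1 u2
  have hy0 : 0 < |y| := by linarith
  rw [← Real.log_mul hy0.ne' (by linarith)]
  have m1 := mul_le_mul_of_nonneg_right h1 hy0.le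
  have m2 := mul_le_mul_of_nonneg_right h2 hy0.le
  have m3 : 2 * 100 ≤ |y| * G := mul_le_mul hy hG (by norm_num) hy0.le
  apply log_near4 _ _ (by positivity) <;> linarith

lemma log_form (b p q : ℝ) (u v : ℤ) (hp : p ≠ 0) (hq : q ≠ 0) (h : |b| = |p| ^ u * |q| ^ v) :
    (u : ℝ) * Real.log |p| + (v : ℝ) * Real.log |q| = Real.log |b| := by
  rw [h, Real.log_mul (zpow_ne_zero _ (abs_ne_zero.2 hp)) (zpow_ne_zero _ (abs_ne_zero.2 hq)),
    Real.log_zpow, Real.log_zpow]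

end ExpBound

open ExpBound in
/-- Bound on the exponents `u₁, u₂` in the representation
`β = ± η₁^{u₁} η₂^{u₂}` of the unit `β = x - α y`:
`max {|u₁|, |u₂|} < 2 log|y| / n + 2`. -/
theorem exponent_bound (n : ℕ) (hn : 29 ≤ n)
    (α : Fin 3 → ℝ)
    (hord : α 0 < α 1 ∧ α 1 < α 2)
    (hroot : ∀ i, α i * (α i - (Nat.fib n : ℝ)) * (α i - 2 ^ n) - 1 = 0)
    (x y : ℤ)
    (heq : x * (x - (Nat.fib n : ℤ) * y) * (x - 2 ^ n * y) - y ^ 3 = 1 ∨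
           x * (x - (Nat.fib n : ℤ) * y) * (x - 2 ^ n * y) - y ^ 3 = -1)
    (hy : 2 ≤ |y|)
    (β : Fin 3 → ℝ) (hβ : ∀ i, β i = (x : ℝ) - α i * (y : ℝ))
    (j : Fin 3) (hmin : ∀ i, |β j| ≤ |β i|)
    (u1 u2 : ℤ)
    (hu : ∀ i, i ≠ j → |β i| = (|α i|) ^ u1 * (|α i - (Nat.fib n : ℝ)|) ^ u2) :
    (max |u1| |u2| : ℝ) < 2 * Real.log (|(y : ℝ)|) / (n : ℝ) + 2 := by

  obtain ⟨f1, f2, f3⟩ := fib_bounds n hn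
  have g1 : (2 : ℝ) ^ n ≤ (Nat.fib n : ℝ) ^ 2 := by exact_mod_cast f1
  have g2 : 10 * (Nat.fib n : ℝ) ≤ 2 ^ n := by
    have : (100 : ℝ) * (Nat.fib n : ℝ) ≤ 2 ^ n * 10 := by exact_mod_cast f2
    linarith
  have g3 : (1000 : ℝ) ≤ (Nat.fib n : ℝ) := by exact_mod_cast f3
  have hlT : Real.log ((2 : ℝ) ^ n) = n * Real.log 2 := Real.log_pow 2 n
  have hprod : |β 0| * |β 1| * |β 2| = 1 := by
    rw [← abs_mul, ← abs_mul, hβ, hβ, hβ,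
      vieta _ _ _ _ _ _ _ hord.1 hord.2 (hroot 0) (hroot 1) (hroot 2)]
    rcases heq with h | h
    · have h' : (x : ℝ) * (x - (Nat.fib n : ℝ) * y) * (x - 2 ^ n * y) - (y : ℝ) ^ 3 = 1 := by
        exact_mod_cast h
      rw [h']; simp
    · have h' : (x : ℝ) * (x - (Nat.fib n : ℝ) * y) * (x - 2 ^ n * y) - (y : ℝ) ^ 3 = -1 := by
        exact_mod_cast h
      rw [h']; simp
  have hj1 : |β j| ≤ 1 := by
    by_contra hc
    push Not at hc
    have k0 := hc.trans_le (hmin 0)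
    have k1 := hc.trans_le (hmin 1)
    have k2 := hc.trans_le (hmin 2)
    have := one_lt_mul_of_lt_of_le k0 k1.le
    have := one_lt_mul_of_lt_of_le this k2.le
    linarith
  obtain ⟨⟨a1, a2⟩, ⟨b1, b2⟩, c1, c2⟩ :=
    roots_loc _ _ g3 g2 _ _ _ hord.1 hord.2 (hroot 0) (hroot 1) (hroot 2)
  have r0 := hroot 0
  have r1 := hroot 1
  have hyR : (2 : ℝ) ≤ |(y : ℝ)| := by exact_mod_cast hy
  have hY : 0 ≤ Real.log |(y : ℝ)| := Real.log_nonneg (by linarith)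
  rw [hβ] at hj1
  have fm : ∀ i, i ≠ j → α i ≠ 0 → α i - (Nat.fib n : ℝ) ≠ 0 →
      (u1 : ℝ) * Real.log |α i| + (u2 : ℝ) * Real.log |α i - (Nat.fib n : ℝ)|
        = Real.log |(x : ℝ) - α i * y| := by
    intro i hi h1 h2
    have := log_form _ _ _ _ _ h1 h2 (hu i hi)
    rwa [hβ] at this
  have bl : ∀ i G, 100 ≤ G → G / 2 ≤ |α i - α j| → |α i - α j| ≤ 2 * G →
      |Real.log |(x : ℝ) - α i * y| - (Real.log |(y : ℝ)| + Real.log G)| ≤ 2 * Real.log 2 :=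
    fun i G hG h1 h2 => beta_log _ _ _ _ G hyR hG hj1 h1 h2
  have hl := Real.log_two_gt_d9
  have hNR : (29 : ℝ) ≤ (n : ℝ) := by exact_mod_cast hn
  generalize (Nat.fib n : ℝ) = F at *
  generalize (2 : ℝ) ^ n = T at *
  have hF0 : 0 < F := by linarith
  have hT0 : 0 < T := by linarith
  have hA1 : Real.log T / 2 ≤ Real.log F := by
    have := Real.log_le_log hT0 g1
    rw [Real.log_pow] at this
    push_cast at this
    linarith
  have hA2 : Real.log F ≤ Real.log T := Real.log_le_log hF0 (by linarith)
  -- coefficients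
  have inv : ∀ z w : ℝ, 0 < z → z * w = 1 → F * T / 2 ≤ w → w ≤ 2 * (F * T) →
      |Real.log z - -(Real.log F + Real.log T)| ≤ Real.log 2 := by
    intro z w hz hzw h1 h2
    have := log_near w (F * T) (by positivity) h1 h2
    have e : w = z⁻¹ := (eq_inv_of_mul_eq_one_right hzw)
    rw [e, Real.log_inv, Real.log_mul hF0.ne' hT0.ne', abs_sub_comm] at this
    convert this using 2
    ring
  have p0 : |Real.log |α 0| - -(Real.log F + Real.log T)| ≤ Real.log 2 := by
    rw [abs_of_pos a1]
    refine inv _ ((F - α 0) * (T - α 0)) a1 (by linear_combination r0) ?_ ?_ <;> nlinarith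
  have q0 : |Real.log |α 0 - F| - Real.log F| ≤ Real.log 2 := by
    rw [abs_of_neg (by linarith : α 0 - F < 0)]
    apply log_near _ _ hF0 <;> linarith
  have p1 : |Real.log |α 1| - Real.log F| ≤ Real.log 2 := by
    rw [abs_of_pos (by linarith : 0 < α 1)]
    apply log_near _ _ hF0 <;> linarith
  have q1 : |Real.log |α 1 - F| - -(Real.log F + Real.log T)| ≤ Real.log 2 := by
    rw [abs_of_neg (by linarith : α 1 - F < 0)]
    refine inv _ (α 1 * (T - α 1)) (by linarith) (by linear_combination r1) ?_ ?_
    · have : (F - 1) * (T - F) ≤ α 1 * (T - α 1) :=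
        mul_le_mul b1.le (by linarith) (by linarith) (by linarith)
      nlinarith
    · have : α 1 * (T - α 1) ≤ F * T :=
        mul_le_mul b2.le (by linarith) (by linarith) (by linarith)
      nlinarith
  have p2 : |Real.log |α 2| - Real.log T| ≤ Real.log 2 := by
    rw [abs_of_pos (by linarith : 0 < α 2)]
    apply log_near _ _ hT0 <;> linarith
  have q2 : |Real.log |α 2 - F| - Real.log T| ≤ Real.log 2 := by
    rw [abs_of_pos (by linarith : 0 < α 2 - F)]
    apply log_near _ _ hT0 <;> linarith
  have n0 : α 0 ≠ 0 := (by linarith : 0 < α 0).ne'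
  have n0' : α 0 - F ≠ 0 := (by linarith : α 0 - F < 0).ne
  have n1 : α 1 ≠ 0 := (by linarith : 0 < α 1).ne'
  have n1' : α 1 - F ≠ 0 := (by linarith : α 1 - F < 0).ne
  have n2 : α 2 ≠ 0 := (by linarith : 0 < α 2).ne'
  have n2' : α 2 - F ≠ 0 := (by linarith : 0 < α 2 - F).ne'
  have d01 : |α 0 - α 1| = α 1 - α 0 := by rw [abs_of_neg] <;> linarith
  have d10 : |α 1 - α 0| = α 1 - α 0 := by rw [abs_of_pos]; linarith
  have d02 : |α 0 - α 2| = α 2 - α 0 := by rw [abs_of_neg] <;> linarith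
  have d20 : |α 2 - α 0| = α 2 - α 0 := by rw [abs_of_pos]; linarith
  have d12 : |α 1 - α 2| = α 2 - α 1 := by rw [abs_of_neg] <;> linarith
  have d21 : |α 2 - α 1| = α 2 - α 1 := by rw [abs_of_pos]; linarith
  obtain ⟨U, hU⟩ : ∃ U : ℝ, U = max |(u1 : ℝ)| |(u2 : ℝ)| := ⟨_, rfl⟩
  have hU1 : |(u1 : ℝ)| ≤ U := hU ▸ le_max_left _ _
  have hU2 : |(u2 : ℝ)| ≤ U := hU ▸ le_max_right _ _
  have hlT0 : 0 < Real.log T := Real.log_pos (by linarith)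
  have goal : |(u1 : ℝ)| * Real.log T ≤ 1.25 * Real.log |(y : ℝ)| + Real.log T
        + 1.25 * (Real.log 2 * (2 + 2 * U)) ∧
      |(u2 : ℝ)| * Real.log T ≤ 1.25 * Real.log |(y : ℝ)| + Real.log T
        + 1.25 * (Real.log 2 * (2 + 2 * U)) := by
    have hj : j = 0 ∨ j = 1 ∨ j = 2 := by fin_cases j <;> simp
    rcases hj with rfl | rfl | rfl
    · have e1 := perturb _ _ U _ _ _ _ _ _ _ hU1 hU2 p1 q1
        (bl 1 F (by linarith) (by linarith) (by linarith)) (fm 1 (by decide) n1 n1')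
      have e2 := perturb _ _ U _ _ _ _ _ _ _ hU1 hU2 p2 q2
        (bl 2 T (by linarith) (by linarith) (by linarith)) (fm 2 (by decide) n2 n2')
      exact coreA _ _ _ _ _ _ hlT0 hA1 hA2 hY e1 e2
    · have e1 := perturb _ _ U _ _ _ _ _ _ _ hU1 hU2 p0 q0
        (bl 0 F (by linarith) (by linarith) (by linarith)) (fm 0 (by decide) n0 n0')
      have e2 := perturb _ _ U _ _ _ _ _ _ _ hU1 hU2 p2 q2
        (bl 2 T (by linarith) (by linarith) (by linarith)) (fm 2 (by decide) n2 n2')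
      rw [add_comm (_ * _) (_ * _)] at e1 e2
      exact (coreA _ _ _ _ _ _ hlT0 hA1 hA2 hY e1 e2).symm
    · have e1 := perturb _ _ U _ _ _ _ _ _ _ hU1 hU2 p1 q1
        (bl 1 T (by linarith) (by linarith) (by linarith)) (fm 1 (by decide) n1 n1')
      have e2 := perturb _ _ U _ _ _ _ _ _ _ hU1 hU2 p0 q0
        (bl 0 T (by linarith) (by linarith) (by linarith)) (fm 0 (by decide) n0 n0')
      exact coreB _ _ _ _ _ _ hlT0 hA1 hY e1 e2
  have hfin : U < 2 * Real.log |(y : ℝ)| / (n : ℝ) + 2 := by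
    refine finish _ _ (Real.log 2) _ hNR hY (by linarith) ((abs_nonneg _).trans hU1) ?_
    rw [← hlT]
    rcases max_choice |(u1 : ℝ)| |(u2 : ℝ)| with h | h
    · have h' : U = |(u1 : ℝ)| := hU.trans h
      have := goal.1
      rwa [← h'] at this
    · have h' : U = |(u2 : ℝ)| := hU.trans h
      have := goal.2
      rwa [← h'] at this
  rw [hU] at hfin
  push_cast
  exact hfin
end

section
/- Let n > 1000 be an integer, let F_n be the n-th Fibonacci number, let α^(1) < α^(2) < α^(3) be the three real roots of f_n(X) = X·(X − F_n)·(X − 2^n) − 1, and let (x, y) be an integer solution of x·(x − F_n·y)·(x − 2^n·y) − y³ = ±1 with |y| ≥ 2. Set β^(i) = x − α^(i)·y. If |β^(3)| = min{|β^(1)|, |β^(2)|, |β^(3)|} (i.e., the solution has type 3), then log|y| > 1.2^n. -/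
open Polynomial

lemma aux_vieta (p q r F G : ℝ) (hpq : p < q) (hqr : q < r)
    (hp : p * (p - F) * (p - G) - 1 = 0) (hq : q * (q - F) * (q - G) - 1 = 0)
    (hr : r * (r - F) * (r - G) - 1 = 0) :
    p + q + r = F + G ∧ p * q + p * r + q * r = F * G ∧ p * q * r = 1 := by
  have h1 : (p^2+p*q+q^2) - (F+G)*(p+q) + F*G = 0 := by
    have : (p - q) * ((p^2+p*q+q^2) - (F+G)*(p+q) + F*G) = 0 := by linear_combination hp - hq
    rcases mul_eq_zero.1 this with h | h
    · linarith
    · exact h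
  have h2 : (r^2+r*q+q^2) - (F+G)*(r+q) + F*G = 0 := by
    have : (r - q) * ((r^2+r*q+q^2) - (F+G)*(r+q) + F*G) = 0 := by linear_combination hr - hq
    rcases mul_eq_zero.1 this with h | h
    · linarith
    · exact h
  have h3 : p + q + r = F + G := by
    have : (p - r) * (p + q + r - (F + G)) = 0 := by linear_combination h1 - h2
    rcases mul_eq_zero.1 this with h | h
    · linarith
    · linarith
  have h4 : p * q + p * r + q * r = F * G := by
    linear_combination -h1 + (p+q) * h3
  refine ⟨h3, h4, ?_⟩
  linear_combination hp - p^2 * h3 + p * h4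

lemma aux_trace (α : Fin 3 → ℝ) (e1 e2 e3 : ℤ)
    (h1 : α 0 + α 1 + α 2 = e1) (h2 : α 0 * α 1 + α 0 * α 2 + α 1 * α 2 = e2)
    (h3 : α 0 * α 1 * α 2 = e3) (g : ℤ[X]) :
    ∃ N : ℤ, aeval (α 0) g + aeval (α 1) g + aeval (α 2) g = (N : ℝ) := by
  have hpow : ∀ j : ℕ, (∃ N : ℤ, α 0 ^ j + α 1 ^ j + α 2 ^ j = (N:ℝ)) ∧
      (∃ N : ℤ, α 0 ^ (j+1) + α 1 ^ (j+1) + α 2 ^ (j+1) = (N:ℝ)) ∧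
      (∃ N : ℤ, α 0 ^ (j+2) + α 1 ^ (j+2) + α 2 ^ (j+2) = (N:ℝ)) := by
    intro j
    induction j with
    | zero =>
      refine ⟨⟨3, by norm_num⟩, ⟨e1, by simpa using h1⟩, ⟨e1^2 - 2*e2, ?_⟩⟩
      push_cast
      rw [← h1, ← h2]; ring
    | succ j ih =>
      obtain ⟨⟨N0, k0⟩, ⟨N1, k1⟩, ⟨N2, k2⟩⟩ := ih
      refine ⟨⟨N1, k1⟩, ⟨N2, k2⟩, ⟨e1 * N2 - e2 * N1 + e3 * N0, ?_⟩⟩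
      push_cast
      rw [← h1, ← h2, ← h3, ← k0, ← k1, ← k2]; ring
  induction g using Polynomial.induction_on' with
  | add p q hp hq =>
    obtain ⟨N, hN⟩ := hp
    obtain ⟨N', hN'⟩ := hq
    refine ⟨N + N', ?_⟩
    push_cast
    rw [← hN, ← hN']
    simp only [map_add]; ring
  | monomial j c =>
    obtain ⟨N, hN⟩ := (hpow j).1
    refine ⟨c * N, ?_⟩
    push_cast
    rw [← hN]
    simp only [aeval_monomial, algebraMap_int_eq, eq_intCast]; ring

lemma aux_zpow (α : Fin 3 → ℝ) (u v : ℤ[X])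
    (h : ∀ i, aeval (α i) u * aeval (α i) v = 1) (m : ℤ) :
    ∃ g : ℤ[X], ∀ i, aeval (α i) g = (aeval (α i) u) ^ m := by
  rcases Int.eq_nat_or_neg m with ⟨k, rfl | rfl⟩
  · exact ⟨u ^ k, fun i => by simp⟩
  · refine ⟨v ^ k, fun i => ?_⟩
    have : aeval (α i) v = (aeval (α i) u)⁻¹ := by
      exact eq_inv_of_mul_eq_one_right (h i)
    simp [this]

lemma aux_dirichlet (s t : ℝ) (M : ℕ) (hM : 0 < M) :
    ∃ k : ℕ, ∃ a b : ℤ, 0 < k ∧ k ≤ M ^ 3 ∧ |(k:ℝ) * s - a| ≤ 1 / M ∧ |(k:ℝ) * t - b| ≤ 1 / M := by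
  have hM' : (0:ℝ) < M := by exact_mod_cast hM
  obtain ⟨a, k1, hk1, hk1', ha⟩ := Real.exists_int_int_abs_mul_sub_le s (n := M^2) (by positivity)
  obtain ⟨b, k2, hk2, hk2', hb⟩ := Real.exists_int_int_abs_mul_sub_le (k1 * t) hM
  lift k1 to ℕ using hk1.le
  lift k2 to ℕ using hk2.le
  norm_cast at hk1 hk2 hk1' hk2'
  refine ⟨k1 * k2, k2 * a, b, by positivity, ?_, ?_, ?_⟩
  · calc k1 * k2 ≤ M^2 * M := Nat.mul_le_mul hk1' hk2'
      _ = M^3 := by ring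
  · have e : (((k1 * k2 : ℕ):ℝ)) * s - ((k2 * a : ℤ):ℝ) = k2 * (((k1:ℤ):ℝ) * s - a) := by
      push_cast; ring
    rw [e, abs_mul, abs_of_nonneg (by positivity : (0:ℝ) ≤ k2)]
    have h2 : (k2:ℝ) ≤ M := by exact_mod_cast hk2'
    calc (k2:ℝ) * |((k1:ℤ):ℝ) * s - a| ≤ M * (1 / (((M^2:ℕ):ℝ) + 1)) := by gcongr
      _ ≤ M * (1 / ((M:ℝ)^2)) := by push_cast; gcongr; linarith
      _ = 1 / M := by field_simp
  · have e : (((k1 * k2 : ℕ):ℝ)) * t - b = ((k2:ℤ):ℝ) * (((k1:ℤ):ℝ) * t) - b := by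
      push_cast; ring
    rw [e]
    refine hb.trans ?_
    gcongr; linarith

lemma aux_one (q : Fin 3 → ℝ) (hq : ∀ i, 0 < q i)
    (hl : Real.log (q 0) + Real.log (q 1) + Real.log (q 2) = 0)
    (N : ℤ) (hs : q 0 + q 1 + q 2 = N) (h4 : q 0 + q 1 + q 2 < 4) : ∀ i, q i = 1 := by
  have hN : N ≤ 3 := by
    rw [hs] at h4
    have : N < 4 := by exact_mod_cast h4
    omega
  have hN' : (N:ℝ) ≤ 3 := by exact_mod_cast hN
  have hle : ∀ i, Real.log (q i) ≤ q i - 1 := fun i => Real.log_le_sub_one_of_pos (hq i)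
  have h0 := hle 0
  have h1 := hle 1
  have h2 := hle 2
  intro i
  by_contra hne
  have := Real.log_lt_sub_one_of_pos (hq i) hne
  fin_cases i <;> simp at this <;> linarith

/-- location of the roots -/
lemma aux_locate (p q r F G : ℝ) (hpq : p < q) (hqr : q < r) (hF : 10 ≤ F) (hG : 4 * F ≤ G)
    (hp : p * (p - F) * (p - G) - 1 = 0) (hq : q * (q - F) * (q - G) - 1 = 0)
    (hr : r * (r - F) * (r - G) - 1 = 0) :
    0 < p ∧ p < 1 ∧ F - 2 < q ∧ q < F ∧ G < r ∧ r - G ≤ 2 / G ^ 2 := by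
  obtain ⟨h1, h2, h3⟩ := aux_vieta p q r F G hpq hqr hp hq hr
  have key : ∀ z : ℝ, z * (z - F) * (z - G) - 1 = 0 → 0 < z ∧ (z < F ∨ G < z) := by
    intro z hz
    constructor
    · by_contra h
      push Not at h
      have : 0 ≤ (-z) * ((F - z) * (G - z)) :=
        mul_nonneg (by linarith) (mul_nonneg (by linarith) (by linarith))
      nlinarith
    · by_contra h
      push Not at h
      have : 0 ≤ z * ((z - F) * (G - z)) :=
        mul_nonneg (by linarith) (mul_nonneg (by linarith) (by linarith))
      nlinarith
  obtain ⟨p0, pc⟩ := key p hp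
  obtain ⟨q0, qc⟩ := key q hq
  obtain ⟨r0, rc⟩ := key r hr
  have hrG : G < r := by
    rcases rc with h | h
    · linarith
    · exact h
  have hqF : q < F := by
    rcases qc with h | h
    · exact h
    · linarith
  have hrr : r - G ≤ 2 / G ^ 2 := by
    rw [le_div_iff₀ (by nlinarith)]
    have : G * (G / 2) ≤ r * (r - F) := by
      apply mul_le_mul <;> linarith
    nlinarith
  have hrr' : r - G ≤ 1 := by
    refine hrr.trans ?_
    rw [div_le_one (by nlinarith)]
    nlinarith
  have hp1 : p < 1 := by
    by_contra h
    push Not at h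
    have a1 : F / 2 ≤ F - p := by linarith
    have a2 : G / 2 ≤ G - p := by linarith
    have : 1 * ((F / 2) * (G / 2)) ≤ p * ((F - p) * (G - p)) := by
      apply mul_le_mul h _ (by nlinarith) p0.le
      apply mul_le_mul a1 a2 (by linarith) (by linarith)
    nlinarith
  exact ⟨p0, hp1, by linarith, hqF, hrG, hrr⟩

lemma aux_fib (n : ℕ) : (Nat.fib n : ℝ) ≤ 1.62 ^ n ∧ (Nat.fib (n+1) : ℝ) ≤ 1.62 ^ (n+1) := by
  induction n with
  | zero => norm_num
  | succ n ih =>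
    refine ⟨ih.2, ?_⟩
    rw [Nat.fib_add_two]
    push_cast
    have : (0:ℝ) < 1.62 ^ n := by positivity
    have e : (1.62:ℝ) ^ (n+1+1) = 1.62 ^ n * 2.6244 := by ring
    have e' : (1.62:ℝ) ^ (n+1) = 1.62 ^ n * 1.62 := by ring
    rw [e]
    rw [e'] at ih
    linarith [ih.1, ih.2]

set_option exponentiation.threshold 3000 in
lemma aux_growth (n : ℕ) (hn : 1000 ≤ n) : (20000000:ℝ) * n ≤ (250/243) ^ n := by
  induction n, hn using Nat.le_induction with
  | base => norm_num
  | succ n hn ih =>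
    have : (1000:ℝ) ≤ n := by exact_mod_cast hn
    rw [pow_succ]
    push_cast
    linarith

lemma aux_cube (n : ℝ) (hn : 1000 ≤ n) : (n + 1) ^ 3 * 0.81 ≤ n ^ 3 := by
  have h2 : n+1 ≤ 1.001 * n := by linarith
  calc (n+1)^3 * 0.81 ≤ (1.001 * n)^3 * 0.81 := by gcongr
    _ ≤ n^3 := by
      have : (0:ℝ) ≤ n^3 := by positivity
      rw [mul_pow]; norm_num; linarith

set_option exponentiation.threshold 3000 in
lemma aux_growth2 (n : ℕ) (hn : 1000 ≤ n) : (1000000000:ℝ) * n ^ 3 ≤ 2 ^ n := by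
  induction n, hn using Nat.le_induction with
  | base => norm_num
  | succ n hn ih =>
    have h := aux_cube n (by exact_mod_cast hn)
    rw [pow_succ 2 n]
    push_cast
    have : (0:ℝ) ≤ n^3 := by positivity
    linarith

set_option exponentiation.threshold 3000 in
lemma aux_12 (n : ℕ) (hn : 1000 ≤ n) : (n:ℝ) ≤ 1.2 ^ n := by
  induction n, hn using Nat.le_induction with
  | base => norm_num
  | succ n hn ih =>
    have : (1000:ℝ) ≤ n := by exact_mod_cast hn
    rw [pow_succ]
    push_cast
    linarith

set_option exponentiation.threshold 3000 in
lemma aux_81 (n : ℕ) (hn : 1000 ≤ n) : (1000000000:ℝ) * n ^ 3 * 0.81 ^ n ≤ 1 := by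
  induction n, hn using Nat.le_induction with
  | base => norm_num
  | succ n hn ih =>
    have h := aux_cube n (by exact_mod_cast hn)
    refine le_trans ?_ ih
    rw [pow_succ 0.81 n]
    push_cast
    have : (0:ℝ) < 0.81 ^ n := by positivity
    have h2 := mul_le_mul_of_nonneg_right h this.le
    linarith

lemma aux_log_sum (a b c : ℝ) (h : (a * b * c) ^ 2 = 1) :
    a ≠ 0 ∧ b ≠ 0 ∧ c ≠ 0 ∧ Real.log a + Real.log b + Real.log c = 0 := by
  have ha : a ≠ 0 := by rintro rfl; norm_num at h
  have hb : b ≠ 0 := by rintro rfl; norm_num at h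
  have hc : c ≠ 0 := by rintro rfl; norm_num at h
  refine ⟨ha, hb, hc, ?_⟩
  have h1 := congrArg Real.log h
  rw [Real.log_pow, Real.log_mul (mul_ne_zero ha hb) hc, Real.log_mul ha hb, Real.log_one] at h1
  push_cast at h1
  linarith

lemma aux_lt_of_log (q : ℝ) (hq : 0 < q) (h : Real.log q ≤ 1 / 5) : q ≤ 5 / 4 := by
  have h1 : Real.log q⁻¹ ≤ q⁻¹ - 1 := Real.log_le_sub_one_of_pos (by positivity)
  have h2 : q ≤ Real.exp (1/5) := by
    rw [← Real.exp_log hq]; exact Real.exp_le_exp.2 h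
  have h3 := Real.add_one_le_exp (-(1/5) : ℝ)
  have h4 : Real.exp (1/5) * Real.exp (-(1/5)) = 1 := by
    rw [← Real.exp_add]; simp
  have := Real.exp_pos (1/5)
  nlinarith

/-- A bounded power of any unit `x - α y` lies in the group generated by `-1, α, α - F`. -/
lemma aux_unit (n : ℕ) (hn : 0 < n) (F G : ℤ) (α : Fin 3 → ℝ)
    (hroot : ∀ i, α i * (α i - (F : ℝ)) * (α i - (G : ℝ)) - 1 = 0)
    (h1 : α 0 + α 1 + α 2 = (F : ℝ) + G)
    (h2 : α 0 * α 1 + α 0 * α 2 + α 1 * α 2 = (F : ℝ) * G)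
    (h3 : α 0 * α 1 * α 2 = 1) (x y : ℤ) (β : Fin 3 → ℝ)
    (hβ : ∀ i, β i = (x : ℝ) - α i * (y : ℝ)) (hN : (β 0 * β 1 * β 2) ^ 2 = 1)
    (hA0 : |Real.log (α 0)| ≤ 2 * n) (hA1 : |Real.log (α 1)| ≤ 2 * n)
    (hB0 : |Real.log (α 0 - F)| ≤ 2 * n) (hB1 : |Real.log (α 1 - F)| ≤ 2 * n)
    (hdet : Real.log (α 0) * Real.log (α 1 - F) - Real.log (α 1) * Real.log (α 0 - F) ≠ 0) :
    ∃ k : ℕ, ∃ a b : ℤ, 0 < k ∧ k ≤ (80 * n) ^ 3 ∧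
      ∀ i, (k : ℝ) * Real.log (β i) = a * Real.log (α i) + b * Real.log (α i - F) := by
  obtain ⟨a0, a1, a2, hAs⟩ := aux_log_sum (α 0) (α 1) (α 2) (by rw [h3]; norm_num)
  have hBp : (α 0 - F) * (α 1 - F) * (α 2 - F) = 1 := by
    linear_combination h3 - (F:ℝ) * h2 + (F:ℝ)^2 * h1
  obtain ⟨b0, b1, b2, hBs⟩ := aux_log_sum (α 0 - F) (α 1 - F) (α 2 - F) (by rw [hBp]; norm_num)
  obtain ⟨w0, w1, w2, hWs⟩ := aux_log_sum (β 0) (β 1) (β 2) hN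
  have hα : ∀ i, α i ≠ 0 := by intro i; fin_cases i <;> assumption
  have hαF : ∀ i, α i - F ≠ 0 := by intro i; fin_cases i <;> assumption
  have hβ0 : ∀ i, β i ≠ 0 := by intro i; fin_cases i <;> assumption
  set Δ := Real.log (α 0) * Real.log (α 1 - F) - Real.log (α 1) * Real.log (α 0 - F) with hΔ
  obtain ⟨s, hs⟩ : ∃ s, s = (Real.log (β 0) * Real.log (α 1 - F)
    - Real.log (β 1) * Real.log (α 0 - F)) / Δ := ⟨_, rfl⟩
  obtain ⟨t, ht⟩ : ∃ t, t = (Real.log (α 0) * Real.log (β 1)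
    - Real.log (α 1) * Real.log (β 0)) / Δ := ⟨_, rfl⟩
  have e0 : Real.log (β 0) = s * Real.log (α 0) + t * Real.log (α 0 - F) := by
    rw [hs, ht]; field_simp; rw [hΔ]; ring
  have e1 : Real.log (β 1) = s * Real.log (α 1) + t * Real.log (α 1 - F) := by
    rw [hs, ht]; field_simp; rw [hΔ]; ring
  obtain ⟨k, a, b, hk, hk', ha, hb⟩ := aux_dirichlet s t (80 * n) (by positivity)
  refine ⟨k, a, b, hk, hk', ?_⟩
  obtain ⟨gA, hgA⟩ := aux_zpow α X ((X - C F) * (X - C G))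
    (by intro i; simp; linarith [hroot i]) (-a)
  obtain ⟨gB, hgB⟩ := aux_zpow α (X - C F) (X * (X - C G))
    (by intro i; simp; linarith [hroot i]) (-b)
  obtain ⟨N, hNt⟩ := aux_trace α (F + G) (F * G) 1 (by push_cast; exact h1)
    (by push_cast; exact h2) (by push_cast; exact h3) (((C x - X * C y) ^ k * gA * gB) ^ 2)
  have hev : ∀ i, aeval (α i) (((C x - X * C y) ^ k * gA * gB) ^ 2)
      = ((β i) ^ k * (α i) ^ (-a) * (α i - F) ^ (-b)) ^ 2 := by
    intro i
    have t1 := hgA i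
    have t2 := hgB i
    simp only [aeval_X, map_sub, eq_intCast, map_intCast] at t1 t2
    simp only [map_pow, map_mul, map_sub, aeval_X, eq_intCast, map_intCast,
      t1, t2, hβ i]
  rw [hev, hev, hev] at hNt
  have hqpos : ∀ i, 0 < ((β i) ^ k * (α i) ^ (-a) * (α i - F) ^ (-b)) ^ 2 := by
    intro i
    have := pow_ne_zero k (hβ0 i)
    have := zpow_ne_zero (-a) (hα i)
    have := zpow_ne_zero (-b) (hαF i)
    positivity
  have hlog : ∀ i, Real.log (((β i) ^ k * (α i) ^ (-a) * (α i - F) ^ (-b)) ^ 2)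
      = 2 * (k * Real.log (β i) - a * Real.log (α i) - b * Real.log (α i - F)) := by
    intro i
    have u1 := pow_ne_zero k (hβ0 i)
    have u2 := zpow_ne_zero (-a) (hα i)
    have u3 := zpow_ne_zero (-b) (hαF i)
    rw [Real.log_pow, Real.log_mul (mul_ne_zero u1 u2) u3, Real.log_mul u1 u2, Real.log_pow,
      Real.log_zpow, Real.log_zpow]
    push_cast; ring
  have hn' : (0:ℝ) < n := by exact_mod_cast hn
  have hsm : ∀ A B : ℝ, |A| ≤ 2 * n → |B| ≤ 2 * n →
      |(k * s - a) * A + (k * t - b) * B| ≤ 1 / 20 := by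
    intro A B hA hB
    calc |(k * s - a) * A + (k * t - b) * B|
        ≤ |(k * s - a) * A| + |(k * t - b) * B| := abs_add_le _ _
      _ = |k * s - a| * |A| + |k * t - b| * |B| := by rw [abs_mul, abs_mul]
      _ ≤ 1 / ((80 * n : ℕ) : ℝ) * (2 * n) + 1 / ((80 * n : ℕ) : ℝ) * (2 * n) := by gcongr
      _ = 1 / 20 := by push_cast; field_simp; norm_num
  have s0 := abs_le.1 (hsm _ _ hA0 hB0)
  have s1 := abs_le.1 (hsm _ _ hA1 hB1)
  have l0 : Real.log (((β 0) ^ k * (α 0) ^ (-a) * (α 0 - F) ^ (-b)) ^ 2)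
    = 2 * ((k * s - a) * Real.log (α 0) + (k * t - b) * Real.log (α 0 - F)) := by
    rw [hlog, e0]; ring
  have l1 : Real.log (((β 1) ^ k * (α 1) ^ (-a) * (α 1 - F) ^ (-b)) ^ 2)
    = 2 * ((k * s - a) * Real.log (α 1) + (k * t - b) * Real.log (α 1 - F)) := by
    rw [hlog, e1]; ring
  have lsum : Real.log (((β 0) ^ k * (α 0) ^ (-a) * (α 0 - F) ^ (-b)) ^ 2)
    + Real.log (((β 1) ^ k * (α 1) ^ (-a) * (α 1 - F) ^ (-b)) ^ 2)
    + Real.log (((β 2) ^ k * (α 2) ^ (-a) * (α 2 - F) ^ (-b)) ^ 2) = 0 := by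
    rw [hlog, hlog, hlog]
    linear_combination 2 * k * hWs - 2 * a * hAs - 2 * b * hBs
  have q0 := aux_lt_of_log _ (hqpos 0) (by rw [l0]; linarith [s0.1, s0.2])
  have q1 := aux_lt_of_log _ (hqpos 1) (by rw [l1]; linarith [s1.1, s1.2])
  have q2 := aux_lt_of_log _ (hqpos 2) (by linarith [s0.1, s0.2, s1.1, s1.2])
  have hone := aux_one (fun i => ((β i) ^ k * (α i) ^ (-a) * (α i - F) ^ (-b)) ^ 2) hqpos lsum N
    hNt (by linarith)
  intro i
  have h := hlog i
  have h' := hone i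
  beta_reduce at h'
  rw [h', Real.log_one] at h
  linarith

lemma aux_logdiff (u v G : ℝ) (hG : 0 < G) (hv : G / 2 ≤ v) (hu : G / 4 ≤ u)
    (h : |u - v| ≤ 4 / G ^ 2) : |Real.log u - Real.log v| ≤ 16 / G ^ 3 := by
  have hv0 : 0 < v := by linarith
  have hu0 : 0 < u := by linarith
  have h1 := Real.log_le_sub_one_of_pos (div_pos hu0 hv0)
  have h2 := Real.log_le_sub_one_of_pos (div_pos hv0 hu0)
  rw [Real.log_div hu0.ne' hv0.ne'] at h1
  rw [Real.log_div hv0.ne' hu0.ne'] at h2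
  have e1 : u / v - 1 = (u - v) / v := by field_simp
  have e2 : v / u - 1 = (v - u) / u := by field_simp
  rw [e1] at h1
  rw [e2] at h2
  have e3 : (16:ℝ) / G ^ 3 = 4 / G ^ 2 / (G / 4) := by field_simp; norm_num
  have b1 : (u - v) / v ≤ 16 / G ^ 3 := by
    rw [e3]
    apply div_le_div₀ (by positivity) ((le_abs_self _).trans h) (by positivity) (by linarith)
  have b2 : (v - u) / u ≤ 16 / G ^ 3 := by
    rw [e3]
    apply div_le_div₀ (by positivity) _ (by positivity) hu
    rw [abs_sub_comm] at h
    exact (le_abs_self _).trans h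
  rw [abs_le]; constructor <;> linarith

set_option maxHeartbeats 4000000 in
/-- The final estimate, on the level of logarithms. -/
lemma aux_final (n : ℕ) (hn : 1000 ≤ n) (G δ A0 A1 C0 C1 W0 W1 Y : ℝ) (k : ℕ) (a b : ℤ)
    (hG : G = 2 ^ n) (hk : 0 < k) (hk' : k ≤ (80 * n) ^ 3)
    (hδ : δ = C0 - C1) (hδ1 : 1 / G ≤ δ) (hδ2 : δ ≤ 2 * 0.81 ^ n)
    (hη : |W0 - W1 - δ| ≤ 32 / G ^ 3)
    (hC0 : n / 2 ≤ C0) (hC1 : n / 2 ≤ C1) (hA1 : 0 ≤ A1) (hB0 : 0 ≤ -A0 - C0)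
    (hW0 : 0 ≤ W0) (hW0' : W0 ≤ Y + n) (hW1 : 0 ≤ W1) (hW1' : W1 ≤ Y + n)
    (h0 : k * W0 = a * A0 + b * (-A0 - C0)) (h1 : k * W1 = a * A1 + b * (-A1 - C1)) :
    (a = -k ∧ b = -k) ∨ Y > 1.2 ^ n := by
  have hnR : (1000:ℝ) ≤ n := by exact_mod_cast hn
  have hkR : (k:ℝ) ≤ 512000 * n ^ 3 := by
    have : (k:ℝ) ≤ (80 * n) ^ 3 := by exact_mod_cast hk'
    calc (k:ℝ) ≤ (80 * n) ^ 3 := this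
      _ = 512000 * n ^ 3 := by ring
  have hk0 : (0:ℝ) < k := by exact_mod_cast hk
  have hg2 := aux_growth2 n hn
  rw [← hG] at hg2
  have hkG : 1000 * (k:ℝ) ≤ G := by linarith [pow_pos (show (0:ℝ) < n by linarith) 3]
  have hk1 : (1:ℝ) ≤ k := by exact_mod_cast hk
  have hG1 : 1000 ≤ G := by linarith
  have hG0 : 0 < G := by linarith
  have hδ0 : 0 < δ := lt_of_lt_of_le (by positivity) hδ1
  have hη2 : 32 / G ^ 3 ≤ 32 / G ^ 2 * δ := by
    calc 32 / G ^ 3 = 32 / G ^ 2 * (1 / G) := by field_simp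
      _ ≤ _ := by gcongr
  have hkη : k * (32 / G ^ 2) < 1 := by
    rw [← mul_div_assoc, div_lt_one (by positivity)]
    nlinarith
  obtain ⟨P, hP⟩ : ∃ P, P = A1 - A0 := ⟨_, rfl⟩
  have hP1 : (n:ℝ) / 2 ≤ P := by rw [hP]; linarith
  have hD : k * (W0 - W1) = (b - a) * P - b * δ := by
    rw [hP, hδ]; linear_combination h0 - h1
  have hkη' : |k * (W0 - W1 - δ)| < δ := by
    rw [abs_mul, abs_of_pos hk0]
    calc k * |W0 - W1 - δ| ≤ k * (32 / G ^ 2 * δ) := by gcongr; exact hη.trans hη2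
      _ = k * (32 / G ^ 2) * δ := by ring
      _ < 1 * δ := by gcongr
      _ = δ := one_mul _
  by_cases hab : a = b
  · left
    have hb : b = -k := by
      have e : ((k:ℝ) + b) * δ = - (k * (W0 - W1 - δ)) := by
        rw [hab] at hD; linear_combination hD
      have : |((k:ℝ) + b) * δ| < δ := by rw [e, abs_neg]; exact hkη'
      rw [abs_mul, abs_of_pos hδ0] at this
      have h' : |(k:ℝ) + b| < 1 := by
        by_contra hc
        push Not at hc
        nlinarith
      have h'' : |(k:ℤ) + b| < 1 := by exact_mod_cast h'
      rw [Int.abs_lt_one_iff] at h''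
      omega
    exact ⟨hab.trans hb, hb⟩
  · right
    have h81 := aux_81 n hn
    have hkδ : k * δ ≤ 1 := by
      calc k * δ ≤ (512000 * n ^ 3) * (2 * 0.81 ^ n) := by gcongr
        _ ≤ 1000000000 * n ^ 3 * 0.81 ^ n := by
          have : (0:ℝ) ≤ n ^ 3 * 0.81 ^ n := by positivity
          linarith
        _ ≤ 1 := h81
    have hδle : δ ≤ 1 := by
      have := mul_le_mul_of_nonneg_right hk1 hδ0.le
      linarith
    have hba : (1:ℝ) ≤ |(b:ℝ) - a| := by
      have : (1:ℤ) ≤ |b - a| := Int.one_le_abs (sub_ne_zero.2 (Ne.symm hab))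
      exact_mod_cast this
    have hbδ : P / 2 ≤ |(b:ℝ)| * δ := by
      have e : (b:ℝ) * δ = (b - a) * P - (k * (W0 - W1 - δ) + k * δ) := by
        linear_combination hD
      have h1 : |((b:ℝ) - a) * P| ≤ |(b:ℝ) * δ| + |k * (W0 - W1 - δ) + k * δ| := by
        have : ((b:ℝ) - a) * P = b * δ + (k * (W0 - W1 - δ) + k * δ) := by rw [e]; ring
        rw [this]; exact abs_add_le _ _
      have h2 : |k * (W0 - W1 - δ) + k * δ| ≤ 2 := by
        refine (abs_add_le _ _).trans ?_
        rw [abs_of_pos (mul_pos hk0 hδ0)]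
        linarith
      rw [abs_mul, abs_mul, abs_of_pos hδ0, abs_of_pos (show 0 < P by linarith)] at h1
      have : 1 * P ≤ |(b:ℝ) - a| * P := by gcongr; linarith
      linarith
    obtain ⟨Δ, hΔ⟩ : ∃ Δ, Δ = (-A0) * (A1 + C1) - (-A0 - C0) * A1 := ⟨_, rfl⟩
    have hΔ1 : (n:ℝ) ^ 2 / 4 ≤ Δ := by
      have e : Δ = (-A0 - C0) * C1 + C0 * A1 + C0 * C1 := by rw [hΔ]; ring
      rw [e]
      have t1 : 0 ≤ (-A0 - C0) * C1 := mul_nonneg hB0 (by linarith)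
      have t2 : 0 ≤ C0 * A1 := mul_nonneg (by linarith) hA1
      have t3 : ((n:ℝ)/2) * (n/2) ≤ C0 * C1 := by gcongr; linarith
      have t4 : (n:ℝ) ^ 2 / 4 = ((n:ℝ)/2) * (n/2) := by ring
      linarith
    have hk2 : k * (W0 * A1 + W1 * (-A0)) = - b * Δ := by
      rw [hΔ]; linear_combination A1 * h0 - A0 * h1
    have hA0 : 0 ≤ -A0 := by linarith
    have hup : W0 * A1 + W1 * (-A0) ≤ (Y + n) * P := by
      rw [hP]
      have := mul_le_mul_of_nonneg_right hW0' hA1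
      have := mul_le_mul_of_nonneg_right hW1' hA0
      linarith
    have hlow : |(b:ℝ)| * Δ ≤ k * ((Y + n) * P) := by
      have hΔ0 : 0 ≤ Δ := le_trans (by positivity) hΔ1
      calc |(b:ℝ)| * Δ = |- (b:ℝ) * Δ| := by rw [abs_mul, abs_neg, abs_of_nonneg hΔ0]
        _ = |k * (W0 * A1 + W1 * (-A0))| := by rw [hk2]
        _ = k * (W0 * A1 + W1 * (-A0)) := abs_of_nonneg (by positivity)
        _ ≤ _ := by gcongr
    have hPpos : 0 < P := by linarith
    have hmain : (n:ℝ) ^ 2 / 8 ≤ k * (Y + n) * δ := by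
      have s1 : P / 2 * (n ^ 2 / 4) ≤ (|(b:ℝ)| * δ) * Δ := by gcongr
      have s2 : (|(b:ℝ)| * Δ) * δ ≤ k * ((Y + n) * P) * δ := by gcongr
      have s3 : P * (n ^ 2 / 8) ≤ P * (k * (Y + n) * δ) := by linarith
      exact le_of_mul_le_mul_left s3 hPpos
    have hYn : 0 ≤ Y + n := hW0.trans hW0'
    have hmain2 : (n:ℝ) ^ 2 / 8 ≤ (512000 * n ^ 3) * (Y + n) * (2 * 0.81 ^ n) := by
      refine hmain.trans ?_
      gcongr
    have hmain3 : 1 ≤ 8192000 * n * (Y + n) * 0.81 ^ n := by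
      have : (n:ℝ)^2 * 1 ≤ n^2 * (8192000 * n * (Y + n) * 0.81 ^ n) := by linarith
      exact le_of_mul_le_mul_left this (by positivity)
    have hgr := aux_growth n hn
    have h12 := aux_12 n hn
    have e : ((250:ℝ)/243) ^ n * 1.2 ^ n * 0.81 ^ n = 1 := by
      rw [← mul_pow, ← mul_pow]; norm_num
    by_contra hY
    push Not at hY
    have h81p : (0:ℝ) < 0.81 ^ n := by positivity
    have h12p : (0:ℝ) < 1.2 ^ n := by positivity
    have c1 : 8192000 * n * (Y + n) * 0.81 ^ n ≤ 8192000 * n * (1.2 ^ n + 1.2 ^ n) * 0.81 ^ n := by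
      gcongr
    have c2 : (20000000 * n) * (1.2:ℝ) ^ n * 0.81 ^ n ≤ 1 := by
      rw [← e]; gcongr
    have c3 : 0 < n * (1.2:ℝ) ^ n * 0.81 ^ n := by positivity
    linarith

set_option maxHeartbeats 4000000 in
/-- For `n > 1000`, a solution `(x, y)` with `|y| ≥ 2` of type `3`
(i.e. `|β⁽³⁾|` minimal) satisfies `log |y| > 1.2ⁿ`. -/
theorem lower_bound_log_y_type3 (n : ℕ) (hn : 1000 < n)
    (α : Fin 3 → ℝ)
    (hord : α 0 < α 1 ∧ α 1 < α 2)
    (hroot : ∀ i, α i * (α i - (Nat.fib n : ℝ)) * (α i - 2 ^ n) - 1 = 0)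
    (x y : ℤ)
    (heq : x * (x - (Nat.fib n : ℤ) * y) * (x - 2 ^ n * y) - y ^ 3 = 1 ∨
           x * (x - (Nat.fib n : ℤ) * y) * (x - 2 ^ n * y) - y ^ 3 = -1)
    (hy : 2 ≤ |y|)
    (β : Fin 3 → ℝ) (hβ : ∀ i, β i = (x : ℝ) - α i * (y : ℝ))
    (hmin : ∀ i, |β 2| ≤ |β i|) :
    Real.log (|(y : ℝ)|) > (1.2 : ℝ) ^ n := by
  have hn' : 1000 ≤ n := hn.le
  have hnR : (1000:ℝ) ≤ n := by exact_mod_cast hn'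
  obtain ⟨F, hF⟩ : ∃ F : ℝ, F = (Nat.fib n : ℝ) := ⟨_, rfl⟩
  obtain ⟨G, hG⟩ : ∃ G : ℝ, G = 2 ^ n := ⟨_, rfl⟩
  have hroot' : ∀ i, α i * (α i - F) * (α i - G) - 1 = 0 := by rw [hF, hG]; exact hroot
  have hF10 : 10 ≤ F := by
    have h1 : Nat.fib 7 ≤ Nat.fib n := Nat.fib_mono (by omega)
    have h2 : 13 ≤ Nat.fib n := by
      have h7 : Nat.fib 7 = 13 := by decide
      omega
    have h3 : (13:ℝ) ≤ Nat.fib n := by exact_mod_cast h2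
    rw [hF]; linarith
  have hGpos : 0 < G := by rw [hG]; positivity
  have hFG : F ≤ 0.81 ^ n * G := by
    rw [hF, hG, ← mul_pow]
    refine (aux_fib n).1.trans (le_of_eq ?_)
    norm_num
  have h81 := aux_81 n hn'
  have h81p : (0:ℝ) < 0.81 ^ n := by positivity
  have hn3 : (1:ℝ) ≤ n ^ 3 := one_le_pow₀ (by linarith)
  have hG4 : 4 * F ≤ G := by
    have h4 : 1 * (0.81:ℝ) ^ n ≤ n ^ 3 * 0.81 ^ n := by gcongr
    have : 4 * (0.81:ℝ) ^ n ≤ 1 := by linarith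
    have := mul_le_mul_of_nonneg_right this hGpos.le
    linarith
  obtain ⟨v1, v2, v3⟩ := aux_vieta _ _ _ F G hord.1 hord.2 (hroot' 0) (hroot' 1) (hroot' 2)
  obtain ⟨p0, p1, q1, q2, r1, r2⟩ := aux_locate _ _ _ F G hord.1 hord.2 hF10 hG4
    (hroot' 0) (hroot' 1) (hroot' 2)
  have hNorm : β 0 * β 1 * β 2 = x * (x - F * y) * (x - G * y) - y ^ 3 := by
    rw [hβ, hβ, hβ]
    linear_combination (-(x:ℝ)^2 * y) * v1 + (x:ℝ) * y^2 * v2 - (y:ℝ)^3 * v3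
  have hNorm2 : (β 0 * β 1 * β 2) ^ 2 = 1 := by
    rw [hNorm, hF, hG]
    rcases heq with h | h
    · have h' : (x:ℝ) * (x - (Nat.fib n : ℝ) * y) * (x - 2 ^ n * y) - y ^ 3 = 1 := by
        exact_mod_cast h
      rw [h']; norm_num
    · have h' : (x:ℝ) * (x - (Nat.fib n : ℝ) * y) * (x - 2 ^ n * y) - y ^ 3 = -1 := by
        exact_mod_cast h
      rw [h']; norm_num
  have hNabs : |β 0| * |β 1| * |β 2| = 1 := by
    rw [← abs_mul, ← abs_mul]
    rcases mul_self_eq_one_iff.1 ((sq _).symm.trans hNorm2) with h | h <;> rw [h] <;> norm_num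
  have hyR : (2:ℝ) ≤ |(y:ℝ)| := by exact_mod_cast hy
  have hy0 : (y:ℝ) ≠ 0 := by
    intro h; rw [h] at hyR; norm_num at hyR
  have hβlow : ∀ i, α i < F → G / 2 ≤ |β i| := by
    intro i hi
    have e : β i - β 2 = (α 2 - α i) * y := by rw [hβ, hβ]; ring
    have h1 : |β i - β 2| ≤ |β i| + |β 2| := abs_sub _ _
    rw [e, abs_mul, abs_of_pos (by linarith)] at h1
    have h2 : (α 2 - α i) * 2 ≤ (α 2 - α i) * |(y:ℝ)| :=
      mul_le_mul_of_nonneg_left hyR (by linarith)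
    have := hmin i
    linarith
  have hb0 := hβlow 0 (by linarith)
  have hb1 := hβlow 1 q2
  have hβ2 : |β 2| ≤ 4 / G ^ 2 := by
    rw [le_div_iff₀ (by positivity)]
    have : (G / 2) * (G / 2) ≤ |β 0| * |β 1| := by gcongr
    have h2 := mul_le_mul_of_nonneg_right this (abs_nonneg (β 2))
    rw [hNabs] at h2
    linarith
  obtain ⟨X, hX⟩ : ∃ X : ℝ, X = x / y := ⟨_, rfl⟩
  have hβX : ∀ i, β i = y * (X - α i) := by
    intro i; rw [hβ, hX]; field_simp
  have hXG : |X - G| ≤ 4 / G ^ 2 := by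
    have h1 : |X - α 2| ≤ 2 / G ^ 2 := by
      have e := hβX 2
      have : 2 * |X - α 2| ≤ |(y:ℝ)| * |X - α 2| := by gcongr
      rw [← abs_mul, ← e] at this
      have e2 : (4:ℝ) / G^2 = 2 * (2 / G^2) := by ring
      linarith
    have e : X - G = (X - α 2) + (α 2 - G) := by ring
    rw [e]
    refine (abs_add_le _ _).trans ?_
    rw [abs_of_pos (show 0 < α 2 - G by linarith)]
    have e2 : (4:ℝ) / G^2 = 2 / G^2 + 2 / G^2 := by ring
    linarith
  have hXG1 : |X - G| ≤ 1 := by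
    refine hXG.trans ?_
    rw [div_le_one (by positivity)]
    have : (2:ℝ) ^ 2 ≤ G ^ 2 := pow_le_pow_left₀ (by norm_num) (by linarith) 2
    linarith
  have hXG2 := abs_le.1 hXG1
  have hlogG : Real.log G = n * Real.log 2 := by rw [hG, Real.log_pow]
  have hl2a := Real.log_two_gt_d9
  have hl2b := Real.log_two_lt_d9
  have hC : ∀ z, z ≤ F → n / 2 ≤ Real.log (G - z) := by
    intro z hz
    have h1 : Real.log (G / 2) ≤ Real.log (G - z) := Real.log_le_log (by linarith) (by linarith)
    rw [Real.log_div (by linarith) (by norm_num), hlogG] at h1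
    have := mul_le_mul_of_nonneg_left hl2a.le (show (0:ℝ) ≤ n by linarith)
    linarith
  have hup : ∀ z, 0 < z → z ≤ 2 * G → Real.log z ≤ n := by
    intro z hz hz'
    have h1 : Real.log z ≤ Real.log (2 * G) := Real.log_le_log hz hz'
    rw [Real.log_mul (by norm_num) (by linarith), hlogG] at h1
    have := mul_le_mul_of_nonneg_left hl2b.le (show (0:ℝ) ≤ n by linarith)
    linarith
  have hABC : ∀ i, 0 < α i → α i < F →
      Real.log (α i) + Real.log (F - α i) + Real.log (G - α i) = 0 := by
    intro i hi hi'
    refine (aux_log_sum _ _ _ ?_).2.2.2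
    have : α i * (F - α i) * (G - α i) = 1 := by linarith [hroot' i]
    rw [this]; norm_num
  have hpF : α 0 < F := by linarith
  have hq0 : 0 < α 1 := by linarith
  have hABC0 := hABC 0 p0 hpF
  have hABC1 := hABC 1 hq0 q2
  have hC0 := hC (α 0) hpF.le
  have hC1 := hC (α 1) q2.le
  have hC0u := hup (G - α 0) (by linarith) (by linarith)
  have hC1u := hup (G - α 1) (by linarith) (by linarith)
  have hA1 : 0 ≤ Real.log (α 1) := Real.log_nonneg (by linarith)
  have hA1u := hup (α 1) hq0 (by linarith)
  have hB0 : 0 ≤ Real.log (F - α 0) := Real.log_nonneg (by linarith)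
  have hB0u := hup (F - α 0) (by linarith) (by linarith)
  have hBneg : ∀ i, Real.log (α i - F) = Real.log (F - α i) := by
    intro i; rw [← Real.log_neg_eq_log]; congr 1; ring
  have hCneg : ∀ i, Real.log (α i - G) = Real.log (G - α i) := by
    intro i; rw [← Real.log_neg_eq_log]; congr 1; ring
  have cF : (((Nat.fib n : ℤ)) : ℝ) = F := by rw [hF]; push_cast; rfl
  have cG : (((2 ^ n : ℤ)) : ℝ) = G := by rw [hG]; push_cast; rfl
  obtain ⟨k, a, b, hk, hk', hkab⟩ := aux_unit n (by omega) (Nat.fib n : ℤ) (2 ^ n) α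
    (by rw [cF, cG]; exact hroot') (by rw [cF, cG]; exact v1) (by rw [cF, cG]; exact v2) v3
    x y β hβ hNorm2
    (by rw [abs_le]; constructor <;> linarith) (by rw [abs_le]; constructor <;> linarith)
    (by rw [cF, hBneg, abs_le]; constructor <;> linarith)
    (by rw [cF, hBneg, abs_le]; constructor <;> linarith)
    (by
      rw [cF, hBneg, hBneg]
      apply ne_of_gt
      have e0 : Real.log (α 0) = - Real.log (F - α 0) - Real.log (G - α 0) := by linarith
      have e1 : Real.log (F - α 1) = - Real.log (α 1) - Real.log (G - α 1) := by linarith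
      have t1 : 0 < Real.log (G - α 0) * Real.log (G - α 1) :=
        mul_pos (by linarith) (by linarith)
      have t2 : 0 ≤ Real.log (F - α 0) * Real.log (G - α 1) :=
        mul_nonneg hB0 (by linarith)
      have t3 : 0 ≤ Real.log (G - α 0) * Real.log (α 1) :=
        mul_nonneg (by linarith) hA1
      rw [e0, e1]
      linarith)
  rw [cF] at hkab
  have hlogβ : ∀ i, α i < F → Real.log (β i) = Real.log |(y:ℝ)| + Real.log (X - α i) := by
    intro i hi
    rw [hβX, Real.log_mul hy0 (by linarith [hXG2.1]), Real.log_abs]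
  have hW : ∀ i, 0 < α i → α i < F → 0 ≤ Real.log (β i) ∧ Real.log (β i) ≤ Real.log |(y:ℝ)| + n := by
    intro i hi hi'
    constructor
    · rw [← Real.log_abs]
      exact Real.log_nonneg (by linarith [hβlow i hi'])
    · rw [hlogβ i hi']
      have := hup (X - α i) (by linarith [hXG2.1]) (by linarith [hXG2.2])
      linarith
  have hdiff : ∀ i, α i < F → |Real.log (X - α i) - Real.log (G - α i)| ≤ 16 / G ^ 3 := by
    intro i hi
    apply aux_logdiff _ _ _ hGpos (by linarith) (by linarith [hXG2.1])
    have : X - α i - (G - α i) = X - G := by ring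
    rw [this]; exact hXG
  have hGp : 0 < G - α 0 := by linarith
  have hGq : 0 < G - α 1 := by linarith
  have hδ1 : 1 / G ≤ Real.log (G - α 0) - Real.log (G - α 1) := by
    have h1 := Real.log_le_sub_one_of_pos (div_pos hGq hGp)
    rw [Real.log_div hGq.ne' hGp.ne'] at h1
    have e : (G - α 1) / (G - α 0) - 1 = - ((α 1 - α 0) / (G - α 0)) := by field_simp; ring
    have h2 : 1 / G ≤ (α 1 - α 0) / (G - α 0) :=
      div_le_div₀ (by linarith) (by linarith) hGp (by linarith)
    linarith
  have hδ2 : Real.log (G - α 0) - Real.log (G - α 1) ≤ 2 * 0.81 ^ n := by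
    have h1 := Real.log_le_sub_one_of_pos (div_pos hGp hGq)
    rw [Real.log_div hGp.ne' hGq.ne'] at h1
    have e : (G - α 0) / (G - α 1) - 1 = (α 1 - α 0) / (G - α 1) := by field_simp; ring
    have h2 : (α 1 - α 0) / (G - α 1) ≤ 2 * 0.81 ^ n := by
      rw [div_le_iff₀ hGq]
      have : 2 * (0.81:ℝ) ^ n * (G / 2) ≤ 2 * 0.81 ^ n * (G - α 1) := by gcongr; linarith
      linarith
    linarith
  have hη : |Real.log (β 0) - Real.log (β 1) - (Real.log (G - α 0) - Real.log (G - α 1))|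
      ≤ 32 / G ^ 3 := by
    rw [hlogβ 0 hpF, hlogβ 1 q2]
    have d0 := abs_le.1 (hdiff 0 hpF)
    have d1 := abs_le.1 (hdiff 1 q2)
    have e : (32:ℝ) / G ^ 3 = 16 / G ^ 3 + 16 / G ^ 3 := by ring
    rw [e, abs_le]
    constructor <;> linarith [d0.1, d0.2, d1.1, d1.2]
  have hk0 := hkab 0
  have hk1 := hkab 1
  rw [hBneg] at hk0 hk1
  rcases aux_final n hn' G _ (Real.log (α 0)) (Real.log (α 1)) (Real.log (G - α 0))
    (Real.log (G - α 1)) (Real.log (β 0)) (Real.log (β 1)) (Real.log |(y:ℝ)|) k a b hG hk hk' rfl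
    hδ1 hδ2 hη hC0 hC1 hA1 (by linarith) (hW 0 p0 hpF).1 (hW 0 p0 hpF).2 (hW 1 hq0 q2).1
    (hW 1 hq0 q2).2
    (by rw [hk0]; congr 2; linarith) (by rw [hk1]; congr 2; linarith) with ⟨ha, hb⟩ | h
  · exfalso
    have hkp : (0:ℝ) < k := by exact_mod_cast hk
    have hne : ∀ i, α i ≠ 0 ∧ α i - F ≠ 0 ∧ α i - G ≠ 0 := by
      intro i
      have h := aux_log_sum (α i) (α i - F) (α i - G) (by
        rw [show α i * (α i - F) * (α i - G) = 1 by linarith [hroot' i]]; norm_num)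
      exact ⟨h.1, h.2.1, h.2.2.1⟩
    have hβne := aux_log_sum _ _ _ hNorm2
    have hβne' : ∀ i, β i ≠ 0 := by
      intro i; fin_cases i
      · exact hβne.1
      · exact hβne.2.1
      · exact hβne.2.2.1
    have hsq : ∀ i, ((x:ℝ) - α i * y) ^ 2 = (α i - G) ^ 2 := by
      intro i
      have h := hkab i
      have h3 := (aux_log_sum (α i) (α i - F) (α i - G) (by
        rw [show α i * (α i - F) * (α i - G) = 1 by linarith [hroot' i]]; norm_num)).2.2.2
      rw [ha, hb] at h
      push_cast at h
      have h4 : (k:ℝ) * Real.log (β i) = k * Real.log (α i - G) := by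
        linear_combination h + (-(k:ℝ)) * h3
      have h5 := mul_left_cancel₀ hkp.ne' h4
      rw [← Real.log_abs, ← Real.log_abs (α i - G)] at h5
      have h6 := Real.log_injOn_pos (abs_pos.2 (hβne' i)) (abs_pos.2 (hne i).2.2) h5
      rw [← hβ i]
      exact (sq_eq_sq_iff_abs_eq_abs _ _).2 h6
    have g0 := hsq 0
    have g1 := hsq 1
    have g2 := hsq 2
    have k1 : (α 0 + α 1) * ((y:ℝ)^2 - 1) - 2 * (x * y - G) = 0 := by
      have : (α 0 - α 1) * ((α 0 + α 1) * ((y:ℝ)^2 - 1) - 2 * (x * y - G)) = 0 := by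
        linear_combination g0 - g1
      rcases mul_eq_zero.1 this with h | h
      · linarith [hord.1]
      · exact h
    have k2 : (α 2 + α 1) * ((y:ℝ)^2 - 1) - 2 * (x * y - G) = 0 := by
      have : (α 2 - α 1) * ((α 2 + α 1) * ((y:ℝ)^2 - 1) - 2 * (x * y - G)) = 0 := by
        linear_combination g2 - g1
      rcases mul_eq_zero.1 this with h | h
      · linarith [hord.2]
      · exact h
    have k3 : (α 2 - α 0) * ((y:ℝ)^2 - 1) = 0 := by linear_combination k2 - k1
    rcases mul_eq_zero.1 k3 with h | h
    · linarith [hord.1, hord.2]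
    · have : |(y:ℝ)|^2 = 1 := by rw [sq_abs]; linarith
      have h4 : (2:ℝ) ^ 2 ≤ |(y:ℝ)| ^ 2 := pow_le_pow_left₀ (by norm_num) hyR 2
      linarith
  · exact h
end
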